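/- arXiv:2303.15002 — 4 statements merged into one kernel-verified Lean document; each statement's English description precedes it below -/
import Mathlib

section
/- The set D224 of all linear orders on {1,...,8} satisfying the listed never-laws has exactly 224 elements (and is, by construction, a Condorcet domain). -/
/-- The (1-indexed) rank of the element `x` within the triple `{a, b, c}` under the
linear order `w` on `Fin n`, where `w k` is the element ranked in position `k`
(so `w.symm y` is the position of the element `y`). -/
def tripleRank {n : ℕ} (w : Equiv.Perm (Fin n)) (a b c x : Fin n) : ℕ :=
  (({a, b, c} : Finset (Fin n)).filter (fun y => w.symm y ≤ w.symm x)).card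

/-- A Condorcet domain on `X_n = {1, ..., n}` (modelled as `Fin n`): for every triple
`a < b < c` there is an element `x` of the triple and a position `i ∈ {1, 2, 3}` such
that no order of `D` places `x` in position `i` when restricted to `{a, b, c}`. -/
def IsCondorcet (n : ℕ) (D : Set (Equiv.Perm (Fin n))) : Prop :=
  ∀ a b c : Fin n, a < b → b < c →
    ∃ x ∈ ({a, b, c} : Finset (Fin n)), ∃ i ∈ ({1, 2, 3} : Finset ℕ),
      ∀ w ∈ D, tripleRank w a b c x ≠ i

/-- The domain `D224`: all linear orders on `{1, ..., 8}` (modelled as `Fin 8`, with the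
alternative `k` represented by `k - 1 : Fin 8`) satisfying the 56 listed never-laws. -/
def D224 : Set (Equiv.Perm (Fin 8)) :=
  {w | tripleRank w 0 1 2 1 ≠ 3 ∧
    tripleRank w 0 1 3 0 ≠ 3 ∧
    tripleRank w 0 1 4 4 ≠ 1 ∧
    tripleRank w 0 1 5 5 ≠ 1 ∧
    tripleRank w 0 1 6 6 ≠ 1 ∧
    tripleRank w 0 1 7 7 ≠ 1 ∧
    tripleRank w 0 2 3 0 ≠ 3 ∧
    tripleRank w 0 2 4 4 ≠ 1 ∧
    tripleRank w 0 2 5 5 ≠ 1 ∧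
    tripleRank w 0 2 6 6 ≠ 1 ∧
    tripleRank w 0 2 7 7 ≠ 1 ∧
    tripleRank w 0 3 4 0 ≠ 3 ∧
    tripleRank w 0 3 5 0 ≠ 3 ∧
    tripleRank w 0 3 6 0 ≠ 3 ∧
    tripleRank w 0 3 7 0 ≠ 3 ∧
    tripleRank w 0 4 5 0 ≠ 3 ∧
    tripleRank w 0 4 6 0 ≠ 3 ∧
    tripleRank w 0 4 7 7 ≠ 1 ∧
    tripleRank w 0 5 6 6 ≠ 1 ∧
    tripleRank w 0 5 7 0 ≠ 3 ∧
    tripleRank w 0 6 7 0 ≠ 3 ∧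
    tripleRank w 1 2 3 1 ≠ 3 ∧
    tripleRank w 1 2 4 1 ≠ 3 ∧
    tripleRank w 1 2 5 1 ≠ 3 ∧
    tripleRank w 1 2 6 1 ≠ 3 ∧
    tripleRank w 1 2 7 1 ≠ 3 ∧
    tripleRank w 1 3 4 4 ≠ 1 ∧
    tripleRank w 1 3 5 5 ≠ 1 ∧
    tripleRank w 1 3 6 6 ≠ 1 ∧
    tripleRank w 1 3 7 7 ≠ 1 ∧
    tripleRank w 1 4 5 1 ≠ 3 ∧
    tripleRank w 1 4 6 1 ≠ 3 ∧
    tripleRank w 1 4 7 7 ≠ 1 ∧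
    tripleRank w 1 5 6 6 ≠ 1 ∧
    tripleRank w 1 5 7 1 ≠ 3 ∧
    tripleRank w 1 6 7 1 ≠ 3 ∧
    tripleRank w 2 3 4 4 ≠ 1 ∧
    tripleRank w 2 3 5 5 ≠ 1 ∧
    tripleRank w 2 3 6 6 ≠ 1 ∧
    tripleRank w 2 3 7 7 ≠ 1 ∧
    tripleRank w 2 4 5 2 ≠ 3 ∧
    tripleRank w 2 4 6 2 ≠ 3 ∧
    tripleRank w 2 4 7 7 ≠ 1 ∧
    tripleRank w 2 5 6 6 ≠ 1 ∧
    tripleRank w 2 5 7 2 ≠ 3 ∧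
    tripleRank w 2 6 7 2 ≠ 3 ∧
    tripleRank w 3 4 5 3 ≠ 3 ∧
    tripleRank w 3 4 6 3 ≠ 3 ∧
    tripleRank w 3 4 7 7 ≠ 1 ∧
    tripleRank w 3 5 6 6 ≠ 1 ∧
    tripleRank w 3 5 7 3 ≠ 3 ∧
    tripleRank w 3 6 7 3 ≠ 3 ∧
    tripleRank w 4 5 6 6 ≠ 1 ∧
    tripleRank w 4 5 7 7 ≠ 1 ∧
    tripleRank w 4 6 7 7 ≠ 1 ∧
    tripleRank w 5 6 7 6 ≠ 1}

/-- The 56 never-laws `(a, b, c, x, i)`. -/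
def lawsL : List (Fin 8 × Fin 8 × Fin 8 × Fin 8 × ℕ) :=
  [
   (0, 1, 2, 1, 3), (0, 1, 3, 0, 3), (0, 1, 4, 4, 1), (0, 1, 5, 5, 1),
   (0, 1, 6, 6, 1), (0, 1, 7, 7, 1), (0, 2, 3, 0, 3), (0, 2, 4, 4, 1),
   (0, 2, 5, 5, 1), (0, 2, 6, 6, 1), (0, 2, 7, 7, 1), (0, 3, 4, 0, 3),
   (0, 3, 5, 0, 3), (0, 3, 6, 0, 3), (0, 3, 7, 0, 3), (0, 4, 5, 0, 3),
   (0, 4, 6, 0, 3), (0, 4, 7, 7, 1), (0, 5, 6, 6, 1), (0, 5, 7, 0, 3),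
   (0, 6, 7, 0, 3), (1, 2, 3, 1, 3), (1, 2, 4, 1, 3), (1, 2, 5, 1, 3),
   (1, 2, 6, 1, 3), (1, 2, 7, 1, 3), (1, 3, 4, 4, 1), (1, 3, 5, 5, 1),
   (1, 3, 6, 6, 1), (1, 3, 7, 7, 1), (1, 4, 5, 1, 3), (1, 4, 6, 1, 3),
   (1, 4, 7, 7, 1), (1, 5, 6, 6, 1), (1, 5, 7, 1, 3), (1, 6, 7, 1, 3),
   (2, 3, 4, 4, 1), (2, 3, 5, 5, 1), (2, 3, 6, 6, 1), (2, 3, 7, 7, 1),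
   (2, 4, 5, 2, 3), (2, 4, 6, 2, 3), (2, 4, 7, 7, 1), (2, 5, 6, 6, 1),
   (2, 5, 7, 2, 3), (2, 6, 7, 2, 3), (3, 4, 5, 3, 3), (3, 4, 6, 3, 3),
   (3, 4, 7, 7, 1), (3, 5, 6, 6, 1), (3, 5, 7, 3, 3), (3, 6, 7, 3, 3),
   (4, 5, 6, 6, 1), (4, 5, 7, 7, 1), (4, 6, 7, 7, 1), (5, 6, 7, 6, 1)
  ]

/-- Number of the elements `a, b, c` that lie in the list `m`. -/
def cntIn (m : List (Fin 8)) (a b c : Fin 8) : ℕ :=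
  (if a ∈ m then 1 else 0) + ((if b ∈ m then 1 else 0) + (if c ∈ m then 1 else 0))

/-- Whether `x` may be placed right after the (reversed) prefix `l`. -/
def okStep (l : List (Fin 8)) (x : Fin 8) : Bool :=
  !decide (x ∈ l) && lawsL.all (fun t =>
    !decide (t.2.2.2.1 = x) || !decide (cntIn (x :: l) t.1 t.2.1 t.2.2.1 = t.2.2.2.2))

/-- All admissible reversed prefixes of length `n`. -/
def gen : ℕ → List (List (Fin 8))
  | 0 => [[]]
  | n + 1 => (gen n).flatMap (fun l => ((List.finRange 8).filter (okStep l)).map (fun x => x :: l))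

/-- Every step of the reversed word is admissible. -/
def AllOk : List (Fin 8) → Prop
  | [] => True
  | x :: l => AllOk l ∧ okStep l x = true

theorem mem_gen (n : ℕ) (l : List (Fin 8)) : l ∈ gen n ↔ l.length = n ∧ AllOk l := by
  induction n generalizing l with
  | zero =>
    cases l <;> simp [gen, AllOk]
  | succ n ih =>
    cases l with
    | nil => simp [gen]
    | cons x l =>
      simp only [gen, List.mem_flatMap, List.mem_map, List.mem_filter, List.mem_finRange,
        true_and, List.length_cons, AllOk]
      constructor
      · rintro ⟨l', h1, y, h2, h3⟩
        obtain ⟨rfl, rfl⟩ := List.cons.inj h3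
        have := (ih l').1 h1
        exact ⟨by omega, this.2, h2⟩
      · rintro ⟨h1, h2, h3⟩
        exact ⟨l, (ih l).2 ⟨by omega, h2⟩, x, h3, rfl⟩

theorem nodup_gen (n : ℕ) : (gen n).Nodup := by
  induction n with
  | zero => simp [gen]
  | succ n ih =>
    simp only [gen]
    rw [List.nodup_flatMap]
    refine ⟨fun l _ => ?_, ?_⟩
    · refine List.Nodup.map (fun a b h => (List.cons.inj h).1) ?_
      exact (List.nodup_finRange 8).filter _
    · refine List.Pairwise.imp ?_ ih
      intro a b hab
      simp only [Function.onFun, List.disjoint_left, List.mem_map]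
      rintro _ ⟨x, _, rfl⟩ ⟨y, _, h⟩
      exact hab (List.cons.inj h).2.symm

/-- Boolean membership test on lists of numerals, cheap for the kernel. -/
def memN (y : ℕ) : List ℕ → Bool
  | [] => false
  | x :: l => cond (Nat.beq y x) true (memN y l)

/-- Numeral version of the 56 never-laws. -/
def lawsN : List (ℕ × ℕ × ℕ × ℕ × ℕ) :=
  [
   (0, 1, 2, 1, 3), (0, 1, 3, 0, 3), (0, 1, 4, 4, 1), (0, 1, 5, 5, 1),
   (0, 1, 6, 6, 1), (0, 1, 7, 7, 1), (0, 2, 3, 0, 3), (0, 2, 4, 4, 1),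
   (0, 2, 5, 5, 1), (0, 2, 6, 6, 1), (0, 2, 7, 7, 1), (0, 3, 4, 0, 3),
   (0, 3, 5, 0, 3), (0, 3, 6, 0, 3), (0, 3, 7, 0, 3), (0, 4, 5, 0, 3),
   (0, 4, 6, 0, 3), (0, 4, 7, 7, 1), (0, 5, 6, 6, 1), (0, 5, 7, 0, 3),
   (0, 6, 7, 0, 3), (1, 2, 3, 1, 3), (1, 2, 4, 1, 3), (1, 2, 5, 1, 3),
   (1, 2, 6, 1, 3), (1, 2, 7, 1, 3), (1, 3, 4, 4, 1), (1, 3, 5, 5, 1),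
   (1, 3, 6, 6, 1), (1, 3, 7, 7, 1), (1, 4, 5, 1, 3), (1, 4, 6, 1, 3),
   (1, 4, 7, 7, 1), (1, 5, 6, 6, 1), (1, 5, 7, 1, 3), (1, 6, 7, 1, 3),
   (2, 3, 4, 4, 1), (2, 3, 5, 5, 1), (2, 3, 6, 6, 1), (2, 3, 7, 7, 1),
   (2, 4, 5, 2, 3), (2, 4, 6, 2, 3), (2, 4, 7, 7, 1), (2, 5, 6, 6, 1),
   (2, 5, 7, 2, 3), (2, 6, 7, 2, 3), (3, 4, 5, 3, 3), (3, 4, 6, 3, 3),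
   (3, 4, 7, 7, 1), (3, 5, 6, 6, 1), (3, 5, 7, 3, 3), (3, 6, 7, 3, 3),
   (4, 5, 6, 6, 1), (4, 5, 7, 7, 1), (4, 6, 7, 7, 1), (5, 6, 7, 6, 1)
  ]

/-- Numeral version of the test of one law. -/
def lawN (l : List ℕ) (x : ℕ) (t : ℕ × ℕ × ℕ × ℕ × ℕ) : Bool :=
  cond (Nat.beq t.2.2.2.1 x)
    (not (Nat.beq ((memN t.1 (x :: l)).toNat + ((memN t.2.1 (x :: l)).toNat +
      (memN t.2.2.1 (x :: l)).toNat)) t.2.2.2.2)) true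

/-- Test all laws of a list. -/
def allN (l : List ℕ) (x : ℕ) : List (ℕ × ℕ × ℕ × ℕ × ℕ) → Bool
  | [] => true
  | t :: ts => cond (lawN l x t) (allN l x ts) false

/-- Numeral version of `okStep`. -/
def okN (l : List ℕ) (x : ℕ) : Bool :=
  cond (memN x l) false (allN l x lawsN)

/-- The never-laws grouped by their distinguished element. -/
def tblN : List (ℕ × List (ℕ × ℕ × ℕ × ℕ × ℕ)) :=
  [
   (0, [(0, 1, 3, 0, 3), (0, 2, 3, 0, 3), (0, 3, 4, 0, 3), (0, 3, 5, 0, 3),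
     (0, 3, 6, 0, 3), (0, 3, 7, 0, 3), (0, 4, 5, 0, 3), (0, 4, 6, 0, 3), (0, 5, 7, 0, 3),
     (0, 6, 7, 0, 3)]),
   (1, [(0, 1, 2, 1, 3), (1, 2, 3, 1, 3), (1, 2, 4, 1, 3), (1, 2, 5, 1, 3),
     (1, 2, 6, 1, 3), (1, 2, 7, 1, 3), (1, 4, 5, 1, 3), (1, 4, 6, 1, 3), (1, 5, 7, 1, 3),
     (1, 6, 7, 1, 3)]),
   (2, [(2, 4, 5, 2, 3), (2, 4, 6, 2, 3), (2, 5, 7, 2, 3), (2, 6, 7, 2, 3)]),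
   (3, [(3, 4, 5, 3, 3), (3, 4, 6, 3, 3), (3, 5, 7, 3, 3), (3, 6, 7, 3, 3)]),
   (4, [(0, 1, 4, 4, 1), (0, 2, 4, 4, 1), (1, 3, 4, 4, 1), (2, 3, 4, 4, 1)]),
   (5, [(0, 1, 5, 5, 1), (0, 2, 5, 5, 1), (1, 3, 5, 5, 1), (2, 3, 5, 5, 1)]),
   (6, [(0, 1, 6, 6, 1), (0, 2, 6, 6, 1), (0, 5, 6, 6, 1), (1, 3, 6, 6, 1),
     (1, 5, 6, 6, 1), (2, 3, 6, 6, 1), (2, 5, 6, 6, 1), (3, 5, 6, 6, 1), (4, 5, 6, 6, 1),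
     (5, 6, 7, 6, 1)]),
   (7, [(0, 1, 7, 7, 1), (0, 2, 7, 7, 1), (0, 4, 7, 7, 1), (1, 3, 7, 7, 1),
     (1, 4, 7, 7, 1), (2, 3, 7, 7, 1), (2, 4, 7, 7, 1), (3, 4, 7, 7, 1), (4, 5, 7, 7, 1),
     (4, 6, 7, 7, 1)])
  ]

/-- Test a table entry. -/
def okP (l : List ℕ) (p : ℕ × List (ℕ × ℕ × ℕ × ℕ × ℕ)) : Bool :=
  cond (memN p.1 l) false (allN l p.1 p.2)

/-- Numeral version of `gen`. -/
def genN : ℕ → List (List ℕ)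
  | 0 => [[]]
  | n + 1 => (genN n).flatMap (fun l =>
      (tblN.filter (okP l)).map (fun p => p.1 :: l))

theorem memN_map (y : Fin 8) (l : List (Fin 8)) :
    memN y.val (l.map Fin.val) = decide (y ∈ l) := by
  induction l with
  | nil => rfl
  | cons x l ih =>
    rw [List.map_cons, memN, ih, Bool.eq_iff_iff]
    by_cases h : y = x
    · simp [h]
    · have : Nat.beq y.val x.val = false := by
        rw [← Bool.not_eq_true, Nat.beq_eq]
        exact fun e => h (Fin.ext e)
      simp [h, this]

theorem allN_eq (l : List ℕ) (x : ℕ) (ts : List (ℕ × ℕ × ℕ × ℕ × ℕ)) :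
    allN l x ts = ts.all (lawN l x) := by
  induction ts with
  | nil => rfl
  | cons t ts ih =>
    rw [allN, ih, List.all_cons]
    cases lawN l x t <;> rfl

theorem lawsN_eq : lawsN = lawsL.map
    (fun t => (t.1.val, t.2.1.val, t.2.2.1.val, t.2.2.2.1.val, t.2.2.2.2)) := by
  rfl

theorem okN_map (l : List (Fin 8)) (x : Fin 8) : okN (l.map Fin.val) x.val = okStep l x := by
  have hlaw : ∀ t : Fin 8 × Fin 8 × Fin 8 × Fin 8 × ℕ,
      lawN (l.map Fin.val) x.val (t.1.val, t.2.1.val, t.2.2.1.val, t.2.2.2.1.val, t.2.2.2.2) =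
      (!decide (t.2.2.2.1 = x) || !decide (cntIn (x :: l) t.1 t.2.1 t.2.2.1 = t.2.2.2.2)) := by
    intro t
    have e : (x.val :: l.map Fin.val) = (x :: l).map Fin.val := rfl
    simp only [lawN, e, memN_map, cntIn]
    rw [Bool.eq_iff_iff]
    by_cases h : t.2.2.2.1 = x
    · simp [h, Bool.toNat, Bool.cond_eq_ite, ← Bool.not_eq_true, Nat.beq_eq]
    · have : Nat.beq t.2.2.2.1.val x.val = false := by
        rw [← Bool.not_eq_true, Nat.beq_eq]
        exact fun e => h (Fin.ext e)
      simp [h, this]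
  rw [okN, okStep, allN_eq, lawsN_eq, List.all_map, memN_map]
  simp only [Function.comp_def, hlaw]
  cases decide (x ∈ l) <;> rfl

theorem tblN_eq : tblN = (List.finRange 8).map
    (fun x => (x.val, lawsN.filter (fun t => Nat.beq t.2.2.2.1 x.val))) := by
  rfl

theorem okP_eq (l : List ℕ) (x : ℕ) :
    okP l (x, lawsN.filter (fun t => Nat.beq t.2.2.2.1 x)) = okN l x := by
  rw [okP, okN, allN_eq, allN_eq, List.all_filter]
  congr 2
  funext t
  simp only [lawN]
  cases Nat.beq t.2.2.2.1 x <;> rfl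

theorem genN_eq (n : ℕ) : genN n = (gen n).map (List.map Fin.val) := by
  induction n with
  | zero => rfl
  | succ n ih =>
    simp only [genN, gen, ih, tblN_eq, okP_eq, List.flatMap_map, List.map_flatMap, List.filter_map, List.map_map,
      Function.comp_def, okN_map, List.map_cons]

theorem genN_length : (genN 8).length = 224 := by
  decide +kernel

theorem gen_length : (gen 8).length = 224 := by
  rw [← genN_length, genN_eq, List.length_map]

theorem AllOk.nodup {l : List (Fin 8)} (h : AllOk l) : l.Nodup := by
  induction l with
  | nil => simp
  | cons x l ih =>
    have h2 := h.2
    simp only [okStep, Bool.and_eq_true, Bool.not_eq_true', decide_eq_false_iff_not] at h2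
    exact List.nodup_cons.2 ⟨h2.1, ih h.1⟩

/-- The reversed prefix of length `k` of the order `w`. -/
def pre (w : Equiv.Perm (Fin 8)) : ℕ → List (Fin 8)
  | 0 => []
  | k + 1 => if h : k < 8 then w ⟨k, h⟩ :: pre w k else pre w k

theorem mem_pre (w : Equiv.Perm (Fin 8)) (y : Fin 8) (k : ℕ) :
    y ∈ pre w k ↔ (w.symm y).val < k := by
  induction k with
  | zero => simp [pre]
  | succ k ih =>
    by_cases h : k < 8
    · simp only [pre, h, dif_pos, List.mem_cons, ih, ← Equiv.symm_apply_eq, Fin.ext_iff]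
      omega
    · have := (w.symm y).isLt
      simp only [pre, h, dif_neg, not_false_eq_true, ih]
      omega

theorem tripleRank_eq (w : Equiv.Perm (Fin 8)) (a b c x : Fin 8) (hab : a ≠ b) (hac : a ≠ c)
    (hbc : b ≠ c) :
    tripleRank w a b c x = cntIn (pre w ((w.symm x).val + 1)) a b c := by
  unfold tripleRank cntIn
  rw [Finset.card_filter, Finset.sum_insert (by simp [hab, hac]), Finset.sum_insert (by simp [hbc]),
    Finset.sum_singleton]
  simp only [mem_pre, Nat.lt_succ_iff, Fin.le_def]

theorem laws_distinct : ∀ t ∈ lawsL, t.1 ≠ t.2.1 ∧ t.1 ≠ t.2.2.1 ∧ t.2.1 ≠ t.2.2.1 := by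
  decide +kernel

theorem mem_D224 (w : Equiv.Perm (Fin 8)) :
    w ∈ D224 ↔ ∀ t ∈ lawsL, tripleRank w t.1 t.2.1 t.2.2.1 t.2.2.2.1 ≠ t.2.2.2.2 := by
  simp only [D224, lawsL, Set.mem_ofPred_eq, List.forall_mem_cons, List.not_mem_nil, false_imp_iff,
    implies_true, and_true]

theorem okStep_pre (w : Equiv.Perm (Fin 8)) (k : ℕ) (hk : k < 8) :
    okStep (pre w k) (w ⟨k, hk⟩) = true ↔ ∀ t ∈ lawsL, t.2.2.2.1 = w ⟨k, hk⟩ →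
      tripleRank w t.1 t.2.1 t.2.2.1 t.2.2.2.1 ≠ t.2.2.2.2 := by
  have hmem : w ⟨k, hk⟩ ∉ pre w k := by simp [mem_pre]
  simp only [okStep, hmem, decide_false, Bool.not_false, Bool.true_and, List.all_eq_true,
    Bool.or_eq_true, Bool.not_eq_true', decide_eq_false_iff_not]
  refine forall₂_congr fun t ht => ?_
  obtain ⟨h1, h2, h3⟩ := laws_distinct t ht
  rw [tripleRank_eq w _ _ _ _ h1 h2 h3, ← imp_iff_not_or]
  refine imp_congr_right fun hx => ?_
  rw [hx]
  simp [pre, hk]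

theorem allOk_pre (w : Equiv.Perm (Fin 8)) (k : ℕ) (hk : k ≤ 8) :
    AllOk (pre w k) ↔ ∀ t ∈ lawsL, (w.symm t.2.2.2.1).val < k →
      tripleRank w t.1 t.2.1 t.2.2.1 t.2.2.2.1 ≠ t.2.2.2.2 := by
  induction k with
  | zero => simp [pre, AllOk]
  | succ k ih =>
    have hk' : k < 8 := hk
    simp only [pre, hk', dif_pos, AllOk, ih hk'.le, okStep_pre]
    constructor
    · rintro ⟨h1, h2⟩ t ht hlt
      rcases Nat.lt_succ_iff_lt_or_eq.1 hlt with h | h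
      · exact h1 t ht h
      · refine h2 t ht ?_
        rw [← Equiv.symm_apply_eq]
        exact Fin.ext h
    · intro h
      refine ⟨fun t ht hlt => h t ht (by omega), fun t ht hx => h t ht ?_⟩
      rw [hx]
      simp

theorem pre_eq (w : Equiv.Perm (Fin 8)) : pre w 8 = (List.ofFn w).reverse := by
  rfl

theorem pre_injective : Function.Injective (fun w : Equiv.Perm (Fin 8) => pre w 8) := by
  intro v w h
  simp only [pre_eq] at h
  exact DFunLike.coe_injective (List.ofFn_injective (List.reverse_injective h))

theorem image_eq :
    (fun w : Equiv.Perm (Fin 8) => pre w 8) '' D224 = ((gen 8).toFinset : Set (List (Fin 8))) := by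
  have key : ∀ w : Equiv.Perm (Fin 8), w ∈ D224 ↔ AllOk (pre w 8) := by
    intro w
    rw [mem_D224, allOk_pre w 8 le_rfl]
    exact forall₂_congr fun t _ => ⟨fun h _ => h, fun h => h (Fin.isLt _)⟩
  ext l
  simp only [Set.mem_image, List.coe_toFinset, Set.mem_ofPred_eq, mem_gen]
  constructor
  · rintro ⟨w, hw, rfl⟩
    exact ⟨by simp [pre_eq], (key w).1 hw⟩
  · rintro ⟨hl, hok⟩
    have hl' : l.reverse.length = 8 := by simpa using hl
    have hinj : Function.Injective (fun i : Fin 8 => l.reverse.get (Fin.cast hl'.symm i)) := by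
      intro i j hij
      have := (List.nodup_iff_injective_get.1 (List.nodup_reverse.2 hok.nodup)) hij
      simpa [Fin.ext_iff] using this
    let w : Equiv.Perm (Fin 8) := Equiv.ofBijective _ (Finite.injective_iff_bijective.1 hinj)
    have hw : pre w 8 = l := by
      rw [pre_eq, List.reverse_eq_iff]
      apply List.ext_get
      · simp [hl]
      · intro n h1 h2
        rw [List.get_ofFn]
        rfl
    exact ⟨w, (key w).2 (by rw [hw]; exact hok), hw⟩

theorem laws_cover : ∀ a b c : Fin 8, a < b → b < c → ∃ t ∈ lawsL,
    t.1 = a ∧ t.2.1 = b ∧ t.2.2.1 = c := by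
  decide +kernel

theorem laws_valid : ∀ t ∈ lawsL, t.2.2.2.1 ∈ ({t.1, t.2.1, t.2.2.1} : Finset (Fin 8)) ∧
    t.2.2.2.2 ∈ ({1, 2, 3} : Finset ℕ) := by
  decide +kernel

/-- `D224` has exactly 224 elements, and it is a Condorcet domain. -/
theorem stmt1 : D224.ncard = 224 ∧ IsCondorcet 8 D224 := by
  constructor
  · rw [← Set.ncard_image_of_injective D224 pre_injective, image_eq, Set.ncard_coe_finset,
      List.toFinset_card_of_nodup (nodup_gen 8), gen_length]
  · intro a b c hab hbc
    obtain ⟨t, ht, rfl, rfl, rfl⟩ := laws_cover a b c hab hbc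
    obtain ⟨h1, h2⟩ := laws_valid t ht
    exact ⟨_, h1, _, h2, fun w hw => (mem_D224 w).1 hw t ht⟩
end

section
/- Every Condorcet domain on X_8 = {1,...,8} that contains some linear order together with its reverse order has at most 222 elements. -/
/-- The reverse of a linear order `w` on `Fin n`: it ranks the elements in exactly the
opposite way to `w`. -/
def reverseOrder {n : ℕ} (w : Equiv.Perm (Fin n)) : Equiv.Perm (Fin n) :=
  w * Fin.revPerm

namespace CD8

/-- `n` ones. -/
def ones (n : Nat) : Nat := Nat.sub (Nat.pow 2 n) 1
def fac (n : Nat) : Nat := Nat.rec 1 (fun n ih => Nat.mul (Nat.succ n) ih) n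
def full0 : Nat := ones 40320

/-- mask of `c_j ≥ v` in the product index. -/
def G (j v : Nat) : Nat :=
  Nat.mul (Nat.sub (ones (Nat.div 40320 (fac j))) (ones (Nat.mul v (Nat.div 40320 (fac (Nat.succ j))))))
    (Nat.div full0 (ones (Nat.div 40320 (fac j))))

def XE (e : Nat → Nat) (j : Nat) : Nat :=
  Nat.rec 0 (fun v ih => Nat.lor ih (Nat.land (Nat.xor full0 (e (Nat.succ v))) (G j (Nat.succ v)))) j

def EE (j : Nat) : Nat → Nat → Nat :=
  Nat.rec (fun _ v => Nat.rec full0 (fun _ _ => 0) v)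
    (fun j ih i v => Nat.rec full0 (fun v _ =>
      Bool.rec (Nat.lor (ih i (Nat.succ v)) (Nat.land (ih i v) (Nat.xor full0 (XE (ih i) (Nat.succ j)))))
        (G (Nat.succ j) (Nat.succ v)) (Nat.beq i (Nat.succ j))) v) j

def nth (l : List Nat) : Nat → Nat :=
  List.rec (fun _ => 0) (fun a _ ih n => Nat.rec a (fun n _ => ih n) n) l

/-- pairs `(i, j)`, `i < j`, in the order of `j`. -/
def PI : List Nat := [0, 0,1, 0,1,2, 0,1,2,3, 0,1,2,3,4, 0,1,2,3,4,5, 0,1,2,3,4,5,6]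
def PJ : List Nat := [1, 2,2, 3,3,3, 4,4,4,4, 5,5,5,5,5, 6,6,6,6,6,6, 7,7,7,7,7,7,7]
/-- index of the pair `i < j` -/
def pidx (i j : Nat) : Nat := Nat.add (Nat.div (Nat.mul j (Nat.sub j 1)) 2) i

def X0 (k : Nat) : Nat := Nat.rec 0 (fun j _ => XE (EE j (nth PI k)) (Nat.succ j)) (nth PJ k)

/-- first, second, third elements of the 56 triples -/
def TA : List Nat := [0,0,0,0,0,0,0,0,0,0,0,0,0,0,0,0,0,0,0,0,0,1,1,1,1,1,1,1,1,1,1,1,1,1,1,1,2,2,2,2,2,2,2,2,2,2,3,3,3,3,3,3,4,4,4,5]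
def TB : List Nat := [1,1,1,1,1,1,2,2,2,2,2,3,3,3,3,4,4,4,5,5,6,2,2,2,2,2,3,3,3,3,4,4,4,5,5,6,3,3,3,3,4,4,4,5,5,6,4,4,4,5,5,6,5,5,6,6]
def TC : List Nat := [2,3,4,5,6,7,3,4,5,6,7,4,5,6,7,5,6,7,6,7,7,3,4,5,6,7,4,5,6,7,5,6,7,6,7,7,4,5,6,7,5,6,7,6,7,7,5,6,7,6,7,7,6,7,7,7]

/-- patterns 0 : acb, 1 : bac, 2 : bca, 3 : cab; inversion bits of ab, ac, bc -/
def bAB (m : Nat) : Nat := nth [0,1,1,0] m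
def bAC (m : Nat) : Nat := nth [0,0,1,1] m
def bBC (m : Nat) : Nat := nth [1,0,0,1] m

/-- choose a mask or its complement -/
def sel (full x b : Nat) : Nat := Nat.rec (Nat.xor full x) (fun _ _ => x) b

/-- mask of the orders having pattern `m` at triple `t`. -/
def pat (full : Nat) (X : Nat → Nat) (t m : Nat) : Nat :=
  Nat.land (sel full (X (pidx (nth TA t) (nth TB t))) (bAB m))
    (Nat.land (sel full (X (pidx (nth TA t) (nth TC t))) (bAC m))
      (sel full (X (pidx (nth TB t) (nth TC t))) (bBC m)))

/-- inversion number, bit sliced -/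
def cb (k : Nat) : Nat → Nat :=
  Nat.rec (fun _ => 0) (fun k ih i => Nat.xor (ih i) (Nat.rec (X0 k) (fun i c => Nat.land (ih i) c) i)) k

def U0 (ls : List Nat) : Nat :=
  List.rec full0 (fun l _ ih => Nat.land ih (Nat.xor full0 (pat full0 X0 (Nat.div l 4) (Nat.mod l 4)))) ls

/-- the initial planes: 28 inversion planes, universe, 5 planes of the inversion number -/
def fam0 (ls : List Nat) (k : Nat) : Nat :=
  Bool.rec (Nat.land (U0 ls) (Bool.rec (cb 28 (Nat.sub k 29)) (X0 k) (Nat.blt k 28))) (U0 ls) (Nat.beq k 28)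

def split (f : Nat → Nat) (w b k : Nat) : Nat :=
  Nat.lor (Nat.xor (f k) (Nat.land (f k) (f b))) (Nat.shiftLeft (Nat.land (f k) (f b)) w)

def prefx (x : Nat) : Nat := Nat.rec x (fun t ih => Nat.xor ih (Nat.shiftLeft ih (Nat.pow 2 t))) 17

/-- compress; plane 34 is the auxiliary one -/
def comp (f : Nat → Nat) (w r : Nat) : Nat → Nat :=
  Nat.rec (fun k => Bool.rec (f k) (Nat.shiftLeft (Nat.xor (ones w) (f 28)) 1) (Nat.beq k 34))
    (fun r ih k => Bool.rec
      (Nat.lor (Nat.xor (ih k) (Nat.land (ih k) (Nat.land (prefx (ih 34)) (ih 28))))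
        (Nat.shiftRight (Nat.land (ih k) (Nat.land (prefx (ih 34)) (ih 28))) (Nat.pow 2 r)))
      (Nat.xor (ih 34) (Nat.land (ih 34) (prefx (ih 34))))
      (Nat.beq k 34)) r

/-- five passes of a radix sort by inversion number -/
def srt (u : List Nat) (b : Nat) : Nat → Nat :=
  Nat.rec (fam0 (List.tail u)) (fun b ih => Nat.rec
     (comp (split ih 40320 29) 80640 17)
     (fun b' _ => comp (split ih (List.headD u 0) (Nat.add 30 b')) (Nat.mul 2 (List.headD u 0)) 16) b) b

def X (u : List Nat) (k : Nat) : Nat := Nat.shiftLeft (srt u 5 k) 512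
def U (u : List Nat) : Nat := Nat.shiftLeft (ones (List.headD u 0)) 512
def P (u : List Nat) (t m : Nat) : Nat := pat (U u) (X u) t m

/-- table of inversion codes, 28 bits for each vertex -/
def smask (s : Nat) : Nat := Nat.mul (ones s) (Nat.div (ones 917504) (ones (Nat.mul 28 s)))
def spread (x : Nat) : Nat :=
  Nat.rec (fun x => x) (fun r ih x =>
    ih (Nat.land (Nat.lor x (Nat.shiftLeft x (Nat.mul 27 (Nat.pow 2 r)))) (smask (Nat.pow 2 r)))) 15 x
def T28 (u : List Nat) : Nat :=
  Nat.rec 0 (fun k ih => Nat.lor ih (Nat.shiftLeft (spread (X u k)) k)) 28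
def COL : Nat := Nat.mul (ones 28) (Nat.div (ones 637084) (ones 1708))
def tab (u : List Nat) (a : Nat) : Nat :=
  Nat.mod (Nat.land (T28 u) (Nat.mul (Nat.pow (Nat.succ a) 28) COL)) (ones 10444)
def A1 : Nat := ones 61
def A2 : Nat := ones 373
def MM : Nat := Nat.mul (Nat.mul A1 A2) 40427
/-- inversion code of the vertex with key `m + 1` -/
def code (u : List Nat) (m : Nat) : Nat :=
  Nat.rec 0 (fun a _ => Nat.mod (Nat.div (tab u a) (Nat.pow (Nat.mod (Nat.succ m) A2) 28)) 268435456)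
    (Nat.mod (Nat.succ m) A1)

def tbit (i j : Nat) : Nat := Nat.pow 2 (pidx i j)
def tcode (t m : Nat) : Nat :=
  Nat.add (Nat.mul (bAB m) (tbit (nth TA t) (nth TB t)))
    (Nat.add (Nat.mul (bAC m) (tbit (nth TA t) (nth TC t))) (Nat.mul (bBC m) (tbit (nth TB t) (nth TC t))))
def tm (t : Nat) : Nat :=
  Nat.add (tbit (nth TA t) (nth TB t)) (Nat.add (tbit (nth TA t) (nth TC t)) (tbit (nth TB t) (nth TC t)))
/-- mask of the patterns opposite to the one with code `e + 1` at `t` -/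
def opp (u : List Nat) (t e : Nat) : Nat :=
  Bool.rec (Bool.rec (Bool.rec (Bool.rec 0 (P u t 2) (Nat.beq (Nat.succ e) (tcode t 3)))
    (P u t 3) (Nat.beq (Nat.succ e) (tcode t 2)))
    (P u t 0) (Nat.beq (Nat.succ e) (tcode t 1)))
    (P u t 1) (Nat.beq (Nat.succ e) (tcode t 0))

/-- blocks: all triples avoiding the elements `2b, 2b+1`. -/
def BL : Nat → List Nat := Nat.rec [36,37,38,39,40,41,42,43,44,45,46,47,48,49,50,51,52,53,54,55] (fun b _ =>
   Nat.rec [2,3,4,5,15,16,17,18,19,20,30,31,32,33,34,35,52,53,54,55] (fun b _ =>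
   Nat.rec [0,1,4,5,6,9,10,13,14,20,21,24,25,28,29,35,38,39,45,51] (fun _ _ =>
     [0,1,2,3,6,7,8,11,12,15,21,22,23,26,27,30,36,37,40,46]) b) b)
def BM : List Nat := [262042400, 242863297, 166166591, 32767]
def blk (u : List Nat) (b key : Nat) : Nat :=
  List.rec 0 (fun t _ ih => Nat.lor (Nat.rec 0 (fun e _ => opp u t e) (Nat.land (Nat.succ key) (tm t))) ih) (BL b)
def blk' (u : List Nat) (b c : Nat) : Nat := Nat.rec 0 (fun key _ => blk u b key) (Nat.land c (nth BM b))

def CC (u : List Nat) : Nat := Nat.pow 2 (Nat.add 512 (List.headD u 0))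
/-- neighbours of the vertex with key `m + 1` -/
def row (u : List Nat) (m : Nat) : Nat :=
  Nat.rec 0 (fun c _ => Nat.lor (blk' u 0 (Nat.succ c)) (Nat.lor (blk' u 1 (Nat.succ c))
    (Nat.lor (blk' u 2 (Nat.succ c)) (blk' u 3 (Nat.succ c))))) (code u m)

/-- greedy clique -/
def cl (u : List Nat) (fuel : Nat) : Nat → Nat :=
  Nat.rec (fun _ => 0) (fun _ ih Z =>
    (fun p => Nat.rec 0 (fun k _ => Nat.lor p (ih (Nat.land Z (row u k)))) (Nat.mod p MM))
      (Nat.land Z (Nat.sub (CC u) Z))) fuel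

def cov (u : List Nat) (n : Nat) : Nat → Bool :=
  Nat.rec (fun S => Nat.beq S 0) (fun _ ih S => ih (Nat.xor S (cl u 200 S))) n
def leaf (u : List Nat) (S : Nat) : Bool := cov u 222 S

inductive Tr where
  | l : Tr
  | n : Nat → Tr → Tr → Tr

def rem (u : List Nat) (S l : Nat) : Nat :=
  Bool.rec S (Nat.xor S (Nat.land S (P u (Nat.div l 4) (Nat.mod l 4)))) (Nat.blt l 224)
noncomputable def chk (u : List Nat) (t : Tr) : Nat → Bool :=
  Tr.rec (fun S => leaf u S) (fun o _ _ ia ib S =>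
    Bool.rec false (ib (rem u S (Nat.succ (Nat.mul 2 o)))) (ia (rem u S (Nat.mul 2 o)))) t
def rems (u : List Nat) (S : Nat) (ls : List Nat) : Nat := List.rec S (fun l _ ih => rem u ih l) ls

/-- enumeration of all orders -/
def F (u : List Nat) (a r : Nat) : Nat :=
  Nat.rec (U u) (fun i ih => Bool.rec ih
    (Nat.land ih (Bool.rec (X u (pidx i a)) (Nat.xor (U u) (X u (pidx a i))) (Nat.blt a i)))
    (Bool.rec (Nat.testBit r i) false (Nat.beq a i))) 8
def inc (a r : Nat) : Nat :=
  Nat.rec 0 (fun i ih => Bool.rec ih (Nat.lor ih (tbit i a)) (Nat.testBit r i)) a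
def viol (ls : List Nat) (a r : Nat) : Bool :=
  List.rec false (fun l _ ih => Bool.rec ih true
    ((fun x y z => Bool.rec false (Bool.rec (Nat.testBit r z) false (Nat.testBit r x)) (Nat.beq y a))
      (nth [nth TA (Nat.div l 4), nth TB (Nat.div l 4), nth TB (Nat.div l 4), nth TC (Nat.div l 4)] (Nat.mod l 4))
      (nth [nth TC (Nat.div l 4), nth TA (Nat.div l 4), nth TC (Nat.div l 4), nth TA (Nat.div l 4)] (Nat.mod l 4))
      (nth [nth TB (Nat.div l 4), nth TC (Nat.div l 4), nth TA (Nat.div l 4), nth TB (Nat.div l 4)] (Nat.mod l 4)))) ls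
def kids (u : List Nat) (r : Nat) : List (Nat × Nat × Nat) :=
  Nat.rec [] (fun a ih => Bool.rec ih (Bool.rec ((Nat.xor r (Nat.pow 2 a), F u a r, inc a r) :: ih) ih (viol (List.tail u) a r))
    (Nat.testBit r a)) 8
def dleaf (u : List Nat) (S c : Nat) : Bool :=
  Nat.rec false (fun m _ => Nat.beq (code u m) c) (Nat.mod (Nat.land S (Nat.sub (CC u) S)) MM)
def dfs (u : List Nat) (f : Nat) : Nat → Nat → Nat → Bool :=
  Nat.rec (fun _ S c => dleaf u S c) (fun _ ih R S c => Nat.rec false (fun r _ =>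
    List.rec true (fun k _ ik => Bool.rec false ik (ih k.1 (Nat.land S k.2.1) (Nat.lor c k.2.2)))
      (kids u (Nat.succ r))) R) f
end CD8
namespace CD8

abbrev W := Equiv.Perm (Fin 8)

/-- position of an element -/
def pos (w : W) (i : Nat) : Nat := (w.symm (Fin.ofNat 8 i)).val
/-- inversion bit -/
def iv (w : W) (i j : Nat) : Bool := decide (pos w j < pos w i)

/-- `w` has the pattern coded by the literal `l` -/
def hp (w : W) (l : Nat) : Prop := l < 224 ∧
  iv w (nth TA (l / 4)) (nth TB (l / 4)) = decide (bAB (l % 4) = 1) ∧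
  iv w (nth TA (l / 4)) (nth TC (l / 4)) = decide (bAC (l % 4) = 1) ∧
  iv w (nth TB (l / 4)) (nth TC (l / 4)) = decide (bBC (l % 4) = 1)

/-- no two members have opposite patterns -/
def NC (D : Finset W) : Prop := ∀ w ∈ D, ∀ v ∈ D, ∀ o, ¬ (hp w (2 * o) ∧ hp v (2 * o + 1))

def Bnd (L : List Nat) : Prop :=
  ∀ D : Finset W, NC D → (∀ w ∈ D, ∀ l ∈ L, ¬ hp w l) → D.card ≤ 222

theorem Bnd_mono {L L' : List Nat} (h : ∀ l ∈ L', l ∈ L) (b : Bnd L') : Bnd L :=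
  fun D hD hL => b D hD (fun w hw l hl => hL w hw l (h l hl))

theorem Bnd_branch {L : List Nat} (o : Nat) (h1 : Bnd (2 * o :: L)) (h2 : Bnd ((2 * o + 1) :: L)) : Bnd L := by
  intro D hD hL
  by_cases h : ∀ w ∈ D, ¬ hp w (2 * o)
  · apply h1 D hD
    intro w hw l hl
    rcases List.mem_cons.1 hl with rfl | hl
    · exact h w hw
    · exact hL w hw l hl
  · push Not at h
    obtain ⟨w, hw, hp1⟩ := h
    apply h2 D hD
    intro v hv l hl
    rcases List.mem_cons.1 hl with rfl | hl
    · exact fun h => hD w hw v hv o ⟨hp1, h⟩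
    · exact hL v hv l hl

theorem pos_lt (w : W) (i : Nat) : pos w i < 8 := (w.symm _).isLt

theorem pos_inj (w : W) {i j : Nat} (hi : i < 8) (hj : j < 8) (h : pos w i = pos w j) : i = j := by
  have := w.symm.injective (Fin.ext h)
  have := congrArg Fin.val this
  simpa [Fin.ofNat, Nat.mod_eq_of_lt hi, Nat.mod_eq_of_lt hj] using this

theorem iv_ext (w v : W) (h : ∀ i j, i < j → j < 8 → iv w i j = iv v i j) : w = v := by
  have key : ∀ i j : Fin 8, w.symm i < w.symm j ↔ v.symm i < v.symm j := by
    have e : ∀ (w : W) (i : Fin 8), pos w i.val = (w.symm i).val := by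
      intro w i
      simp [pos]
    intro i j
    rcases lt_trichotomy i j with hij | hij | hij
    · have := h i.val j.val hij j.isLt
      simp only [iv, e, decide_eq_decide] at this
      have h1 := fun h => hij.ne (w.symm.injective h)
      have h2 := fun h => hij.ne (v.symm.injective h)
      have h3 : (w.symm j < w.symm i) ↔ (v.symm j < v.symm i) := this
      constructor
      · intro a
        rcases lt_trichotomy (v.symm i) (v.symm j) with c | c | c
        · exact c
        · exact absurd c h2
        · exact absurd (h3.2 c) (not_lt_of_gt a)
      · intro a
        rcases lt_trichotomy (w.symm i) (w.symm j) with c | c | c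
        · exact c
        · exact absurd c h1
        · exact absurd (h3.1 c) (not_lt_of_gt a)
    · subst hij; simp
    · have := h j.val i.val hij i.isLt
      simp only [iv, e, decide_eq_decide] at this
      exact this
  -- the composite is strictly monotone
  have hm : StrictMono (fun k : Fin 8 => v.symm (w k)) := by
    intro a b hab
    apply (key _ _).1
    simpa using hab
  have : (fun k : Fin 8 => v.symm (w k)) = id := by
    have := Subsingleton.elim (hm.orderIsoOfSurjective _ (w.trans v.symm).surjective) (OrderIso.refl (Fin 8))
    funext k
    exact DFunLike.congr_fun this k
  ext k
  have := congrFun this k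
  simp only [id] at this
  rw [Equiv.symm_apply_eq] at this
  rw [this]

/-- lowest bit -/
theorem low (Z : Nat) : ∀ K, Z &&& (2 ^ K - Z) = 0 ∨ ∃ i, Z.testBit i = true ∧ Z &&& (2 ^ K - Z) = 2 ^ i := by
  induction Z using Nat.strong_induction_on with
  | _ Z ih =>
    intro K
    by_cases h0 : Z = 0
    · left; simp [h0]
    by_cases h1 : 2 ^ K < Z
    · left; rw [Nat.sub_eq_zero_of_le h1.le]; simp
    cases K with
    | zero =>
      have : Z = 1 := by simp at h1; omega
      left; simp [this]
    | succ K =>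
      rcases Nat.even_or_odd' Z with ⟨y, hy | hy⟩
      · have e : 2 ^ (K + 1) - Z = 2 * (2 ^ K - y) := by rw [hy, pow_succ]; omega
        have e2 : Z &&& (2 ^ (K + 1) - Z) = 2 * (y &&& (2 ^ K - y)) := by
          rw [e, hy]
          apply Nat.eq_of_testBit_eq
          intro i
          cases i with
          | zero => simp
          | succ i => rw [Nat.testBit_land]; simp [Nat.testBit_succ]
        rw [e2]
        rcases ih y (by omega) K with h | ⟨i, hi, h⟩
        · left; rw [h]
        · right
          refine ⟨i + 1, ?_, ?_⟩
          · rw [hy, Nat.testBit_succ]; simpa using hi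
          · rw [h, pow_succ]; ring
      · right
        refine ⟨0, by simp [hy], ?_⟩
        have hlt : y < 2 ^ K := by rw [pow_succ] at h1; omega
        have e : 2 ^ (K + 1) - Z = 2 * (2 ^ K - (y + 1)) + 1 := by rw [hy, pow_succ]; omega
        rw [e, hy]
        apply Nat.eq_of_testBit_eq
        intro i
        cases i with
        | zero => simp
        | succ i =>
          have a1 : (2 * y + 1) / 2 = y := by omega
          have a2 : (2 * (2 ^ K - (y + 1)) + 1) / 2 = 2 ^ K - (y + 1) := by omega
          rw [Nat.testBit_land, Nat.testBit_succ, Nat.testBit_succ, a1, a2, Nat.testBit_two_pow_sub_succ hlt]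
          simp [Nat.testBit_succ]
          tauto

end CD8
namespace CD8

theorem tb_land (a b i : Nat) : (Nat.land a b).testBit i = (a.testBit i && b.testBit i) := Nat.testBit_land a b i
theorem tb_lor (a b i : Nat) : (Nat.lor a b).testBit i = (a.testBit i || b.testBit i) := Nat.testBit_lor a b i
theorem tb_xor (a b i : Nat) : (Nat.xor a b).testBit i = (a.testBit i ^^ b.testBit i) := Nat.testBit_xor a b i

/-- position `k` represents `w` in the masks -/
structure KK (u : List Nat) (w : W) (k : Nat) : Prop where
  hU : (U u).testBit k = true
  hX : ∀ i j, i < j → j < 8 → (X u (pidx i j)).testBit k = iv w i j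
  hc : ∃ m, Nat.mod (2 ^ k) MM = m + 1 ∧ ∀ i j, i < j → j < 8 → (code u m).testBit (pidx i j) = iv w i j

theorem KK_inj {u : List Nat} {w v : W} {k : Nat} (h : KK u w k) (h' : KK u v k) : w = v :=
  iv_ext w v (fun i j hi hj => by rw [← h.hX i j hi hj, h'.hX i j hi hj])

theorem tbl_lt : ∀ t < 56, nth TA t < nth TB t ∧ nth TB t < nth TC t ∧ nth TC t < 8 := by decide +kernel

theorem sel_tb {full x b k : Nat} (hf : full.testBit k = true) (hb : b = 0 ∨ b = 1) :
    (sel full x b).testBit k = (x.testBit k == decide (b = 1)) := by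
  rcases hb with rfl | rfl
  · show (Nat.xor full x).testBit k = _
    rw [tb_xor, hf]; cases x.testBit k <;> rfl
  · show x.testBit k = _
    cases x.testBit k <;> rfl

theorem bits01 : ∀ m < 4, (bAB m = 0 ∨ bAB m = 1) ∧ (bAC m = 0 ∨ bAC m = 1) ∧ (bBC m = 0 ∨ bBC m = 1) := by
  decide +kernel

theorem P_tb {u : List Nat} {w : W} {k : Nat} (h : KK u w k) {l : Nat} (hl : l < 224) :
    (P u (l / 4) (l % 4)).testBit k = true ↔ hp w l := by
  obtain ⟨h1, h2, h3⟩ := tbl_lt (l / 4) (by omega)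
  obtain ⟨b1, b2, b3⟩ := bits01 (l % 4) (by omega)
  unfold P pat
  rw [tb_land, tb_land, sel_tb h.hU b1, sel_tb h.hU b2, sel_tb h.hU b3,
    h.hX _ _ h1 (by omega), h.hX _ _ (by omega) h3, h.hX _ _ h2 h3]
  simp [hp, hl]

theorem tcode_tb : ∀ t < 56, ∀ m < 4,
    (tm t).testBit (pidx (nth TA t) (nth TB t)) = true ∧
    (tm t).testBit (pidx (nth TA t) (nth TC t)) = true ∧
    (tm t).testBit (pidx (nth TB t) (nth TC t)) = true ∧
    (tcode t m).testBit (pidx (nth TA t) (nth TB t)) = decide (bAB m = 1) ∧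
    (tcode t m).testBit (pidx (nth TA t) (nth TC t)) = decide (bAC m = 1) ∧
    (tcode t m).testBit (pidx (nth TB t) (nth TC t)) = decide (bBC m = 1) := by decide +kernel

theorem hp_of_code {w : W} {c : Nat} (hc : ∀ i j, i < j → j < 8 → c.testBit (pidx i j) = iv w i j)
    {t m : Nat} (ht : t < 56) (hm : m < 4) (h : Nat.land c (tm t) = tcode t m) : hp w (4 * t + m) := by
  obtain ⟨h1, h2, h3⟩ := tbl_lt t ht
  obtain ⟨a1, a2, a3, a4, a5, a6⟩ := tcode_tb t ht m hm
  have e1 : (4 * t + m) / 4 = t := by omega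
  have e2 : (4 * t + m) % 4 = m := by omega
  rw [← h] at a4 a5 a6
  rw [tb_land, a1, Bool.and_true] at a4
  rw [tb_land, a2, Bool.and_true] at a5
  rw [tb_land, a3, Bool.and_true] at a6
  refine ⟨by omega, ?_, ?_, ?_⟩
  · rw [e1, e2, ← a4]; exact (hc _ _ h1 (by omega)).symm
  · rw [e1, e2, ← a5]; exact (hc _ _ (by omega) h3).symm
  · rw [e1, e2, ← a6]; exact (hc _ _ h2 h3).symm

/-- the two orders have opposite patterns somewhere -/
def Conf (w v : W) : Prop := ∃ o, (hp w (2 * o) ∧ hp v (2 * o + 1)) ∨ (hp v (2 * o) ∧ hp w (2 * o + 1))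

theorem opp_spec {u : List Nat} {w v : W} {k : Nat} (h : KK u v k) {c t e : Nat}
    (hc : ∀ i j, i < j → j < 8 → c.testBit (pidx i j) = iv w i j) (ht : t < 56)
    (he : Nat.land c (tm t) = e + 1) (hb : (opp u t e).testBit k = true) : Conf w v := by
  have key : ∀ m < 4, ∀ m' < 4, e + 1 = tcode t m → (P u t m').testBit k = true →
      hp w (4 * t + m) ∧ hp v (4 * t + m') := by
    intro m hm m' hm' h1 h2
    refine ⟨hp_of_code hc ht hm (he.trans h1), ?_⟩
    apply (P_tb h (by omega)).1
    rw [show (4 * t + m') / 4 = t by omega, show (4 * t + m') % 4 = m' by omega]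
    exact h2
  unfold opp at hb
  cases h0 : Nat.beq (Nat.succ e) (tcode t 0) with
  | true =>
    rw [h0] at hb
    obtain ⟨a, b⟩ := key 0 (by omega) 1 (by omega) (Nat.eq_of_beq_eq_true h0) hb
    exact ⟨2 * t, Or.inl ⟨by convert a using 1; omega, by convert b using 1; omega⟩⟩
  | false =>
  rw [h0] at hb
  cases h1 : Nat.beq (Nat.succ e) (tcode t 1) with
  | true =>
    rw [h1] at hb
    obtain ⟨a, b⟩ := key 1 (by omega) 0 (by omega) (Nat.eq_of_beq_eq_true h1) hb
    exact ⟨2 * t, Or.inr ⟨by convert b using 1; omega, by convert a using 1; omega⟩⟩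
  | false =>
  rw [h1] at hb
  cases h2 : Nat.beq (Nat.succ e) (tcode t 2) with
  | true =>
    rw [h2] at hb
    obtain ⟨a, b⟩ := key 2 (by omega) 3 (by omega) (Nat.eq_of_beq_eq_true h2) hb
    exact ⟨2 * t + 1, Or.inl ⟨by convert a using 1; omega, by convert b using 1; omega⟩⟩
  | false =>
  rw [h2] at hb
  cases h3 : Nat.beq (Nat.succ e) (tcode t 3) with
  | true =>
    rw [h3] at hb
    obtain ⟨a, b⟩ := key 3 (by omega) 2 (by omega) (Nat.eq_of_beq_eq_true h3) hb
    exact ⟨2 * t + 1, Or.inr ⟨by convert b using 1; omega, by convert a using 1; omega⟩⟩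
  | false =>
  rw [h3] at hb
  simp at hb

theorem BL_spec : ∀ b < 4, ∀ t ∈ BL b, t < 56 ∧ Nat.land (nth BM b) (tm t) = tm t := by decide +kernel

theorem blk_spec {u : List Nat} {w v : W} {k : Nat} (h : KK u v k) {c b : Nat} (hb4 : b < 4)
    (hc : ∀ i j, i < j → j < 8 → c.testBit (pidx i j) = iv w i j)
    (hb : (blk' u b c).testBit k = true) : Conf w v := by
  unfold blk' at hb
  cases hk : Nat.land c (nth BM b) with
  | zero => rw [hk] at hb; simp at hb
  | succ key =>
    rw [hk] at hb
    change (blk u b key).testBit k = true at hb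
    unfold blk at hb
    have H : ∀ l : List Nat, (∀ t ∈ l, t < 56 ∧ Nat.land (nth BM b) (tm t) = tm t) →
      (List.rec (motive := fun _ => Nat) 0 (fun t _ ih => Nat.lor (Nat.rec 0 (fun e _ => opp u t e) (Nat.land (Nat.succ key) (tm t))) ih) l : Nat).testBit k = true → Conf w v := by
      intro l
      induction l with
      | nil => intro _ h; simp at h
      | cons t l ih =>
        intro hl hb
        change (Nat.lor _ _).testBit k = true at hb
        rw [tb_lor, Bool.or_eq_true] at hb
        rcases hb with hb | hb
        · obtain ⟨ht, hm⟩ := hl t (by simp)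
          have e1 : Nat.land (Nat.succ key) (tm t) = Nat.land c (tm t) := by
            rw [← Nat.add_one, ← hk]
            show (c &&& nth BM b) &&& tm t = c &&& tm t
            rw [Nat.land_assoc]
            exact congrArg (fun x => c &&& x) hm
          rw [e1] at hb
          cases he : Nat.land c (tm t) with
          | zero => rw [he] at hb; simp at hb
          | succ e =>
            rw [he] at hb
            exact opp_spec h hc ht he hb
        · exact ih (fun t ht => hl t (by simp [ht])) hb
    exact H _ (BL_spec b hb4) hb

theorem row_spec {u : List Nat} {w v : W} {k m : Nat} (h : KK u v k)
    (hc : ∀ i j, i < j → j < 8 → (code u m).testBit (pidx i j) = iv w i j)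
    (hb : (row u m).testBit k = true) : Conf w v := by
  unfold row at hb
  generalize code u m = c at hc hb
  cases c with
  | zero => simp at hb
  | succ c =>
    change (Nat.lor _ (Nat.lor _ (Nat.lor _ _))).testBit k = true at hb
    rw [tb_lor, tb_lor, tb_lor] at hb
    simp only [Bool.or_eq_true] at hb
    rcases hb with hb | hb | hb | hb
    · exact blk_spec h (by omega) hc hb
    · exact blk_spec h (by omega) hc hb
    · exact blk_spec h (by omega) hc hb
    · exact blk_spec h (by omega) hc hb

theorem CC_eq (u : List Nat) : CC u = 2 ^ (512 + List.headD u 0) := rfl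

theorem cl_succ (u : List Nat) (f Z : Nat) : cl u (f + 1) Z =
    Nat.rec 0 (fun k _ => Nat.lor (Nat.land Z (Nat.sub (CC u) Z)) (cl u f (Nat.land Z (row u k))))
      (Nat.mod (Nat.land Z (Nat.sub (CC u) Z)) MM) := rfl

theorem lowC (u : List Nat) (Z : Nat) : Nat.land Z (Nat.sub (CC u) Z) = 0 ∨
    ∃ i, Z.testBit i = true ∧ Nat.land Z (Nat.sub (CC u) Z) = 2 ^ i := by
  rw [CC_eq]; exact low Z _

theorem cl_sub (u : List Nat) (f : Nat) : ∀ Z i, (cl u f Z).testBit i = true → Z.testBit i = true := by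
  induction f with
  | zero => intro Z i h; simp [cl] at h
  | succ f ih =>
    intro Z i h
    rw [cl_succ] at h
    cases hm : Nat.mod (Nat.land Z (Nat.sub (CC u) Z)) MM with
    | zero => rw [hm] at h; simp at h
    | succ m =>
      rw [hm] at h
      change (Nat.lor _ _).testBit i = true at h
      rw [tb_lor, Bool.or_eq_true] at h
      rcases h with h | h
      · rw [tb_land, Bool.and_eq_true] at h; exact h.1
      · have := ih _ _ h
        rw [tb_land, Bool.and_eq_true] at this; exact this.1

theorem cl_clique (u : List Nat) (D : Finset W) (κ : W → Nat) (hκ : ∀ w ∈ D, KK u w (κ w))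
    (hD : NC D) (f : Nat) : ∀ Z, ∀ w ∈ D, ∀ v ∈ D, (cl u f Z).testBit (κ w) = true →
      (cl u f Z).testBit (κ v) = true → w = v := by
  have nconf : ∀ w ∈ D, ∀ v ∈ D, ¬ Conf w v := by
    rintro w hw v hv ⟨o, h | h⟩
    · exact hD w hw v hv o h
    · exact hD v hv w hw o h
  induction f with
  | zero => intro Z w _ v _ h; simp [cl] at h
  | succ f ih =>
    intro Z w hw v hv h1 h2
    rw [cl_succ] at h1 h2
    cases hm : Nat.mod (Nat.land Z (Nat.sub (CC u) Z)) MM with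
    | zero => rw [hm] at h1; simp at h1
    | succ m =>
      rw [hm] at h1 h2
      change (Nat.lor _ _).testBit _ = true at h1 h2
      rw [tb_lor, Bool.or_eq_true] at h1 h2
      rcases lowC u Z with h0 | ⟨i, _, hi⟩
      · rw [h0] at hm; simp [Nat.mod] at hm
      · have key : ∀ w ∈ D, ∀ v ∈ D, (2 ^ i).testBit (κ w) = true →
            (cl u f (Nat.land Z (row u m))).testBit (κ v) = true → w = v := by
          intro w hw v hv a b
          exfalso
          rw [Nat.testBit_two_pow] at a
          have a : i = κ w := by simpa using a
          obtain ⟨m', hm', hc⟩ := (hκ w hw).hc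
          rw [← a, ← hi, hm] at hm'
          have : m = m' := by omega
          subst this
          have b := cl_sub u f _ _ b
          rw [tb_land, Bool.and_eq_true] at b
          exact nconf w hw v hv (row_spec (hκ v hv) hc b.2)
        rw [hi] at h1 h2
        rcases h1 with h1 | h1 <;> rcases h2 with h2 | h2
        · rw [Nat.testBit_two_pow] at h1 h2
          have a : i = κ w := by simpa using h1
          have b : i = κ v := by simpa using h2
          have e := hκ w hw
          rw [← a, b] at e
          exact KK_inj e (hκ v hv)
        · exact key w hw v hv h1 h2
        · exact (key v hv w hw h2 h1).symm
        · exact ih _ w hw v hv h1 h2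

theorem cov_spec (u : List Nat) (D : Finset W) (κ : W → Nat) (hκ : ∀ w ∈ D, KK u w (κ w))
    (hD : NC D) (n : Nat) : ∀ S, cov u n S = true → (D.filter (fun w => S.testBit (κ w) = true)).card ≤ n := by
  induction n with
  | zero =>
    intro S h
    have : S = 0 := Nat.eq_of_beq_eq_true h
    simp [this]
  | succ n ih =>
    intro S h
    have h' : cov u n (Nat.xor S (cl u 200 S)) = true := h
    have := ih _ h'
    have hsub : D.filter (fun w => S.testBit (κ w) = true) ⊆
        D.filter (fun w => (Nat.xor S (cl u 200 S)).testBit (κ w) = true) ∪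
        D.filter (fun w => (cl u 200 S).testBit (κ w) = true) := by
      intro w hw
      rw [Finset.mem_filter] at hw
      rw [Finset.mem_union, Finset.mem_filter, Finset.mem_filter, tb_xor, hw.2]
      cases (cl u 200 S).testBit (κ w) <;> simp [hw.1]
    have h1 : (D.filter (fun w => (cl u 200 S).testBit (κ w) = true)).card ≤ 1 := by
      rw [Finset.card_le_one]
      intro w hw v hv
      rw [Finset.mem_filter] at hw hv
      exact cl_clique u D κ hκ hD 200 S w hw.1 v hv.1 hw.2 hv.2
    have h2 := Finset.card_le_card hsub
    have h3 := Finset.card_union_le (D.filter (fun w => (Nat.xor S (cl u 200 S)).testBit (κ w) = true))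
      (D.filter (fun w => (cl u 200 S).testBit (κ w) = true))
    omega

theorem rem_spec {u : List Nat} {w : W} {k : Nat} (h : KK u w k) {S l : Nat} (hS : S.testBit k = true)
    (hl : ¬ hp w l) : (rem u S l).testBit k = true := by
  unfold rem
  cases hb : Nat.blt l 224 with
  | false => exact hS
  | true =>
    have hlt : l < 224 := by simpa [Nat.blt_eq] using hb
    show (Nat.xor S (Nat.land S (P u (l / 4) (l % 4)))).testBit k = true
    have : (P u (l / 4) (l % 4)).testBit k = false := by
      rw [← Bool.not_eq_true, P_tb h hlt]; exact hl
    rw [tb_xor, tb_land, hS, this]; rfl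

theorem chk_spec (u : List Nat) (t : Tr) : ∀ (S : Nat) (D : Finset W) (κ : W → Nat),
    (∀ w ∈ D, KK u w (κ w)) → NC D → (∀ w ∈ D, S.testBit (κ w) = true) → chk u t S = true → D.card ≤ 222 := by
  induction t with
  | l =>
    intro S D κ hκ hD hS h
    have := cov_spec u D κ hκ hD 222 S h
    rwa [Finset.filter_true_of_mem hS] at this
  | n o a b iha ihb =>
    intro S D κ hκ hD hS h
    change Bool.rec false (chk u b (rem u S (Nat.succ (Nat.mul 2 o)))) (chk u a (rem u S (Nat.mul 2 o))) = true at h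
    cases ha : chk u a (rem u S (Nat.mul 2 o)) with
    | false => rw [ha] at h; simp at h
    | true =>
      rw [ha] at h
      have hb : chk u b (rem u S (Nat.succ (Nat.mul 2 o))) = true := h
      by_cases hw : ∀ w ∈ D, ¬ hp w (2 * o)
      · exact iha _ D κ hκ hD (fun w hw' => rem_spec (hκ w hw') (hS w hw') (hw w hw')) ha
      · push Not at hw
        obtain ⟨w, hw, hp1⟩ := hw
        exact ihb _ D κ hκ hD (fun v hv => rem_spec (hκ v hv) (hS v hv)
          (fun h => hD w hw v hv o ⟨hp1, h⟩)) hb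

theorem rems_spec {u : List Nat} {w : W} {k : Nat} (h : KK u w k) {S : Nat} (hS : S.testBit k = true)
    (ls : List Nat) (hl : ∀ l ∈ ls, ¬ hp w l) : (rems u S ls).testBit k = true := by
  induction ls with
  | nil => exact hS
  | cons l ls ih =>
    exact rem_spec h (ih (fun l h => hl l (by simp [h]))) (hl l (by simp))

end CD8
namespace CD8

theorem nrec8 {α : Type} (z : α) (f : Nat → α → α) : Nat.rec (motive := fun _ => α) z f 8 =
    f 7 (f 6 (f 5 (f 4 (f 3 (f 2 (f 1 (f 0 z))))))) := rfl

/-- partial version of the mask -/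
def Fp (u : List Nat) (a r n : Nat) : Nat :=
  Nat.rec (U u) (fun i ih => Bool.rec ih
    (Nat.land ih (Bool.rec (X u (pidx i a)) (Nat.xor (U u) (X u (pidx a i))) (Nat.blt a i)))
    (Bool.rec (Nat.testBit r i) false (Nat.beq a i))) n

theorem Fp_spec (u : List Nat) (a r n k : Nat) (h : (Fp u a r n).testBit k = true) :
    (U u).testBit k = true ∧ ∀ i < n, i ≠ a → r.testBit i = true →
      (a < i → (X u (pidx a i)).testBit k = false) ∧ (i < a → (X u (pidx i a)).testBit k = true) := by
  induction n with
  | zero => exact ⟨h, by omega⟩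
  | succ n ih =>
    have h' : (Bool.rec (Fp u a r n)
      (Nat.land (Fp u a r n) (Bool.rec (X u (pidx n a)) (Nat.xor (U u) (X u (pidx a n))) (Nat.blt a n)))
      (Bool.rec (Nat.testBit r n) false (Nat.beq a n) : Bool) : Nat).testBit k = true := h
    have h0 : (Fp u a r n).testBit k = true := by
      revert h'
      cases (Bool.rec (Nat.testBit r n) false (Nat.beq a n) : Bool) with
      | false => exact id
      | true => intro h; change (Nat.land _ _).testBit k = true at h; rw [tb_land, Bool.and_eq_true] at h; exact h.1
    obtain ⟨hU, h1⟩ := ih h0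
    refine ⟨hU, ?_⟩
    intro i hi hia hr
    by_cases hin : i < n
    · exact h1 i hin hia hr
    · have : i = n := by omega
      subst this
      have e1 : Nat.beq a i = false := by
        cases hb : Nat.beq a i with
        | false => rfl
        | true => exact absurd (Nat.eq_of_beq_eq_true hb).symm hia
      rw [e1] at h'
      simp only [hr] at h'
      rw [tb_land, Bool.and_eq_true] at h'
      have h2 := h'.2
      constructor
      · intro hlt
        have e2 : Nat.blt a i = true := by simpa [Nat.blt_eq] using hlt
        rw [e2] at h2
        change (Nat.xor _ _).testBit k = true at h2
        rw [tb_xor, hU] at h2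
        simpa using h2
      · intro hlt
        have e2 : Nat.blt a i = false := by
          cases hb : Nat.blt a i with
          | false => rfl
          | true => have : a < i := by simpa [Nat.blt_eq] using hb
                    omega
        rw [e2] at h2
        exact h2

theorem pidx_inv : ∀ j < 8, ∀ i < j, i = nth PI (pidx i j) ∧ j = nth PJ (pidx i j) := by
  decide +kernel

theorem pidx_inj (j : Nat) (hj : j < 8) (i : Nat) (j' : Nat) (hj' : j' < 8) (i' : Nat)
    (h : i < j) (h' : i' < j') (e : pidx i j = pidx i' j') : i = i' ∧ j = j' := by
  have a := pidx_inv j hj i h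
  have b := pidx_inv j' hj' i' h'
  rw [← e] at b
  exact ⟨a.1.trans b.1.symm, a.2.trans b.2.symm⟩

/-- partial version of the code increment -/
def incp (a r n : Nat) : Nat :=
  Nat.rec 0 (fun i ih => Bool.rec ih (Nat.lor ih (tbit i a)) (Nat.testBit r i)) n

theorem incp_spec (a r n : Nat) (ha : a < 8) (hn : n ≤ a) (i j : Nat) (hij : i < j) (hj : j < 8) :
    (incp a r n).testBit (pidx i j) = decide (j = a ∧ i < n ∧ r.testBit i = true) := by
  induction n with
  | zero => simp [incp]
  | succ n ih =>
    have ih := ih (by omega)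
    show (Bool.rec (incp a r n) (Nat.lor (incp a r n) (tbit n a)) (Nat.testBit r n) : Nat).testBit (pidx i j) = _
    cases hr : r.testBit n with
    | false =>
      show (incp a r n).testBit (pidx i j) = _
      rw [ih, decide_eq_decide]
      constructor
      · rintro ⟨h1, h2, h3⟩; exact ⟨h1, by omega, h3⟩
      · rintro ⟨h1, h2, h3⟩
        refine ⟨h1, ?_, h3⟩
        by_contra h
        have : i = n := by omega
        rw [this, hr] at h3; simp at h3
    | true =>
      show (Nat.lor (incp a r n) (2 ^ pidx n a)).testBit (pidx i j) = _
      rw [tb_lor, ih, Nat.testBit_two_pow]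
      rw [← Bool.decide_or, decide_eq_decide]
      constructor
      · rintro (⟨h1, h2, h3⟩ | h)
        · exact ⟨h1, by omega, h3⟩
        · obtain ⟨rfl, rfl⟩ := pidx_inj a ha n j hj i (by omega) hij h
          exact ⟨rfl, by omega, hr⟩
      · rintro ⟨h1, h2, h3⟩
        by_cases hin : i < n
        · exact Or.inl ⟨h1, hin, h3⟩
        · right
          have : i = n := by omega
          rw [this, h1]

/-- the elements of a literal in the order of the pattern -/
def l1 (l : Nat) : Nat := nth [nth TA (Nat.div l 4), nth TB (Nat.div l 4), nth TB (Nat.div l 4), nth TC (Nat.div l 4)] (Nat.mod l 4)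
def l2 (l : Nat) : Nat := nth [nth TC (Nat.div l 4), nth TA (Nat.div l 4), nth TC (Nat.div l 4), nth TA (Nat.div l 4)] (Nat.mod l 4)
def l3 (l : Nat) : Nat := nth [nth TB (Nat.div l 4), nth TC (Nat.div l 4), nth TA (Nat.div l 4), nth TB (Nat.div l 4)] (Nat.mod l 4)

theorem viol_spec (ls : List Nat) (a r : Nat) (h : viol ls a r = true) :
    ∃ l ∈ ls, l2 l = a ∧ r.testBit (l1 l) = false ∧ r.testBit (l3 l) = true := by
  induction ls with
  | nil => simp [viol] at h
  | cons l ls ih =>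
    change (Bool.rec (viol ls a r) true
      (Bool.rec false (Bool.rec (Nat.testBit r (l3 l)) false (Nat.testBit r (l1 l))) (Nat.beq (l2 l) a) : Bool) : Bool) = true at h
    cases h2 : Nat.beq (l2 l) a with
    | false =>
      rw [h2] at h
      obtain ⟨l, hl, h⟩ := ih h
      exact ⟨l, by simp [hl], h⟩
    | true =>
      rw [h2] at h
      cases h1 : r.testBit (l1 l) with
      | true =>
        simp only [h1] at h
        obtain ⟨l, hl, h⟩ := ih h
        exact ⟨l, by simp [hl], h⟩
      | false =>
        simp only [h1] at h
        cases h3 : r.testBit (l3 l) with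
        | true => exact ⟨l, by simp, Nat.eq_of_beq_eq_true h2, h1, h3⟩
        | false =>
          rw [h3] at h
          obtain ⟨l, hl, h⟩ := ih h
          exact ⟨l, by simp [hl], h⟩

theorem l_lt : ∀ l < 224, l1 l < 8 ∧ l2 l < 8 ∧ l3 l < 8 := by decide +kernel

theorem l_ne : ∀ l < 224, l3 l ≠ l2 l := by decide +kernel

theorem nth0 (a b c d : Nat) : nth [a, b, c, d] 0 = a := rfl
theorem nth1 (a b c d : Nat) : nth [a, b, c, d] 1 = b := rfl
theorem nth2 (a b c d : Nat) : nth [a, b, c, d] 2 = c := rfl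
theorem nth3 (a b c d : Nat) : nth [a, b, c, d] 3 = d := rfl

theorem hp_of_pos (w : W) (l : Nat) (hl : l < 224) (h1 : pos w (l1 l) < pos w (l2 l))
    (h2 : pos w (l2 l) < pos w (l3 l)) : hp w l := by
  refine ⟨hl, ?_⟩
  unfold l1 l2 at h1
  unfold l2 l3 at h2
  change pos w (nth _ (l % 4)) < pos w (nth _ (l % 4)) at h1
  change pos w (nth _ (l % 4)) < pos w (nth _ (l % 4)) at h2
  have e : Nat.div l 4 = l / 4 := rfl
  rw [e] at h1 h2
  have : l % 4 = 0 ∨ l % 4 = 1 ∨ l % 4 = 2 ∨ l % 4 = 3 := by omega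
  rcases this with h | h | h | h <;> rw [h] at h1 h2 ⊢ <;>
    simp only [nth0, nth1, nth2, nth3, bAB, bAC, bBC] at h1 h2 ⊢ <;> simp [iv] <;> omega

/-- partial version of the list of children -/
def kidsp (u : List Nat) (r n : Nat) : List (Nat × Nat × Nat) :=
  Nat.rec [] (fun a ih => Bool.rec ih (Bool.rec ((Nat.xor r (Nat.pow 2 a), F u a r, inc a r) :: ih) ih (viol (List.tail u) a r))
    (Nat.testBit r a)) n

theorem kidsp_mem (u : List Nat) (r n a : Nat) (ha : a < n) (hr : r.testBit a = true)
    (hv : viol (List.tail u) a r = false) : (Nat.xor r (Nat.pow 2 a), F u a r, inc a r) ∈ kidsp u r n := by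
  induction n with
  | zero => omega
  | succ n ih =>
    show _ ∈ (Bool.rec (kidsp u r n) (Bool.rec ((Nat.xor r (Nat.pow 2 n), F u n r, inc n r) :: kidsp u r n) (kidsp u r n) (viol (List.tail u) n r))
      (Nat.testBit r n) : List (Nat × Nat × Nat))
    by_cases h : a = n
    · subst h
      rw [hr, hv]
      exact List.mem_cons_self
    · have ih := ih (by omega)
      cases Nat.testBit r n with
      | false => exact ih
      | true =>
        cases viol (List.tail u) n r with
        | true => exact ih
        | false => exact List.mem_cons_of_mem _ ih


theorem kid_list (l : List (Nat × Nat × Nat)) (g : Nat × Nat × Nat → Bool)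
    (h : (List.rec true (fun k _ ik => Bool.rec false ik (g k)) l : Bool) = true) : ∀ k ∈ l, g k = true := by
  induction l with
  | nil => simp
  | cons k l ih =>
    change (Bool.rec false (List.rec true (fun k _ ik => Bool.rec false ik (g k)) l) (g k) : Bool) = true at h
    cases hg : g k with
    | false => rw [hg] at h; simp at h
    | true =>
      rw [hg] at h
      intro k' hk'
      rcases List.mem_cons.1 hk' with rfl | hk'
      · exact hg
      · exact ih h k' hk'

theorem dfs_succ (u : List Nat) (f r S c : Nat) : dfs u (f + 1) (r + 1) S c =
  (List.rec true (fun k _ ik => Bool.rec false ik (dfs u f k.1 (Nat.land S k.2.1) (Nat.lor c k.2.2)))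
      (kids u (r + 1)) : Bool) := rfl

theorem dfs_zero (u : List Nat) (f S c : Nat) : dfs u (f + 1) 0 S c = false := rfl

theorem pos_surj (w : W) (s : Nat) (hs : s < 8) : ∃ a < 8, pos w a = s := by
  refine ⟨(w ⟨s, hs⟩).val, (w ⟨s, hs⟩).isLt, ?_⟩
  simp [pos]

theorem dfs_spec (u : List Nat) (w : W) (hw : ∀ l ∈ List.tail u, ¬ hp w l) (hls : ∀ l ∈ List.tail u, l < 224) (f : Nat) :
    ∀ s R S c, f + s = 7 → (∀ i, R.testBit i = decide (i < 8 ∧ s ≤ pos w i)) →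
      (∀ k, S.testBit k = true → (U u).testBit k = true ∧ ∀ i j, i < j → j < 8 → pos w i < s ∨ pos w j < s →
        (X u (pidx i j)).testBit k = iv w i j) →
      (∀ i j, i < j → j < 8 → c.testBit (pidx i j) = (iv w i j && decide (pos w j < s))) →
      dfs u f R S c = true → ∃ k, KK u w k := by
  induction f with
  | zero =>
    intro s R S c hs hR hS hc h
    have hs : s = 7 := by omega
    subst hs
    change dleaf u S c = true at h
    unfold dleaf at h
    cases hm : Nat.mod (Nat.land S (Nat.sub (CC u) S)) MM with
    | zero => rw [hm] at h; simp at h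
    | succ m =>
      rw [hm] at h
      have hcode : code u m = c := Nat.eq_of_beq_eq_true h
      rcases lowC u S with h0 | ⟨k, hk, hp⟩
      · rw [h0] at hm; simp [Nat.mod] at hm
      · rw [hp] at hm
        obtain ⟨hU, hX⟩ := hS k hk
        refine ⟨k, hU, ?_, m, hm, ?_⟩
        · intro i j hij hj
          apply hX i j hij hj
          by_contra hcon
          have h1 := pos_lt w i
          have h2 := pos_lt w j
          have := pos_inj w (i := i) (j := j) (by omega) hj (by omega)
          omega
        · intro i j hij hj
          rw [hcode, hc i j hij hj]
          cases hiv : iv w i j with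
          | false => rfl
          | true =>
            have : pos w j < pos w i := by simpa [iv] using hiv
            have := pos_lt w i
            simp; omega
  | succ f ih =>
    intro s R S c hs hR hS hc h
    obtain ⟨a, ha, hpa⟩ := pos_surj w s (by omega)
    have hRa : R.testBit a = true := by rw [hR]; simp [ha, hpa]
    cases R with
    | zero => simp at hRa
    | succ r =>
      rw [dfs_succ] at h
      have hv : viol (List.tail u) a (r + 1) = false := by
        rw [← Bool.not_eq_true]
        intro hv
        obtain ⟨l, hl, e, b1, b3⟩ := viol_spec _ _ _ hv
        apply hw l hl
        have hlt := hls l hl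
        obtain ⟨q1, q2, q3⟩ := l_lt l hlt
        rw [hR] at b1 b3
        simp only [decide_eq_false_iff_not, decide_eq_true_eq, not_and, not_le] at b1 b3
        have b1 := b1 q1
        have b3 := b3.2
        apply hp_of_pos w l hlt
        · rw [e, hpa]; exact b1
        · rw [e, hpa]
          have : l3 l ≠ a := by
            rw [← e]
            exact l_ne l hlt
          rcases Nat.lt_or_eq_of_le b3 with b | b
          · exact b
          · exact absurd (pos_inj w q3 ha (by omega)) this
      have hk := kid_list _ (fun k => dfs u f k.1 (Nat.land S k.2.1) (Nat.lor c k.2.2)) h _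
        (kidsp_mem u (r + 1) 8 a ha hRa hv)
      have key : ∀ i, i < 8 → (s + 1 ≤ pos w i ↔ (s ≤ pos w i ∧ i ≠ a)) := by
        intro i hi
        constructor
        · intro h; refine ⟨by omega, ?_⟩; rintro rfl; omega
        · rintro ⟨h1, h2⟩
          have : pos w i ≠ s := fun h => h2 (pos_inj w hi ha (by omega))
          omega
      refine ih (s + 1) _ _ _ (by omega) ?_ ?_ ?_ hk
      · intro i
        rw [tb_xor, hR]
        show (_ ^^ (2 ^ a).testBit i) = _
        rw [Nat.testBit_two_pow]
        by_cases hi : i < 8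
        · by_cases hia : a = i
          · subst hia; simp [hpa, hi]
          · have := key i hi
            simp only [hi, hia, true_and, decide_false, Bool.xor_false, decide_eq_decide]
            rw [this]
            exact ⟨fun h => ⟨h, fun h => hia h.symm⟩, fun h => h.1⟩
        · have : a ≠ i := by omega
          simp [hi, this]
      · intro k hk
        rw [tb_land, Bool.and_eq_true] at hk
        obtain ⟨hk1, hk2⟩ := hk
        obtain ⟨hU, hX⟩ := hS k hk1
        have hF := (Fp_spec u a (r + 1) 8 k hk2).2
        refine ⟨hU, ?_⟩
        intro i j hij hj hor
        by_cases hold : pos w i < s ∨ pos w j < s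
        · exact hX i j hij hj hold
        · have hi8 : i < 8 := by omega
          have hcase : i = a ∨ j = a := by
            rcases hor with h | h
            · left; exact pos_inj w hi8 ha (by omega)
            · right; exact pos_inj w hj ha (by omega)
          rcases hcase with rfl | rfl
          · have := (hF j hj (by omega) (by rw [hR]; simp; omega)).1 hij
            rw [this]
            simp [iv]; omega
          · have := (hF i hi8 (by omega) (by rw [hR]; simp; omega)).2 hij
            rw [this]
            have : pos w i ≠ pos w j := fun h => by
              have := pos_inj w hi8 ha h
              omega
            simp [iv]; omega
      · intro i j hij hj
        have hinc : (inc a (r + 1)).testBit (pidx i j) = decide (j = a ∧ i < a ∧ (r + 1).testBit i = true) :=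
          incp_spec a (r + 1) a ha (le_refl _) i j hij hj
        show (Nat.lor c (inc a (r + 1))).testBit (pidx i j) = _
        rw [tb_lor, hc i j hij hj, hinc, hR]
        have hi8 : i < 8 := by omega
        have k1 := key i hi8
        have k2 := key j hj
        rw [Bool.eq_iff_iff]
        simp only [iv, Bool.or_eq_true, Bool.and_eq_true, decide_eq_true_eq]
        by_cases hja : j = a
        · subst hja
          omega
        · omega

theorem Bnd_of_check (u ls : List Nat) (t : Tr) (hls : ∀ l ∈ List.tail u, l < 224)
    (h1 : dfs u 7 255 (U u) 0 = true) (h2 : chk u t (rems u (U u) ls) = true) : Bnd (List.tail u ++ ls) := by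
  intro D hD hL
  have hK : ∀ w ∈ D, ∃ k, KK u w k := by
    intro w hw
    refine dfs_spec u w (fun l hl => hL w hw l (by simp [hl])) hls 7 0 255 (U u) 0 rfl ?_ ?_ ?_ h1
    · intro i
      rw [show 255 = 2 ^ 8 - 1 from rfl, Nat.testBit_two_pow_sub_one]
      simp
    · intro k hk
      exact ⟨hk, by intros; omega⟩
    · intro i j _ _
      simp
  classical
  have : ∃ κ : W → Nat, ∀ w ∈ D, KK u w (κ w) := by
    refine ⟨fun w => if h : ∃ k, KK u w k then h.choose else 0, ?_⟩
    intro w hw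
    have := hK w hw
    simp only [this, dif_pos]
    exact this.choose_spec
  obtain ⟨κ, hκ⟩ := this
  exact chk_spec u t _ D κ hκ hD (fun w hw => rems_spec (hκ w hw) (hκ w hw).hU ls
    (fun l hl => hL w hw l (by simp [hl]))) h2

end CD8
namespace CD8

/-- mirror images of the triples -/
def MIR : List Nat := [55, 54, 51, 45, 35, 20, 53, 50, 44, 34, 19, 48, 42, 32, 17, 39, 29, 14, 25, 10, 5, 52, 49, 43, 33, 18, 47, 41, 31, 16, 38, 28, 13, 24, 9, 4, 46, 40, 30, 15, 37, 27, 12, 23, 8, 3, 36, 26, 11, 22, 7, 2, 21, 6, 1, 0]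
def s1 (l : Nat) : Nat := Nat.xor l 2
def s2 (l : Nat) : Nat := 4 * nth MIR (l / 4) + Nat.xor (l % 4) 1

def rv (w : W) : W := w * Fin.revPerm
def fl (w : W) : W := Fin.revPerm * w * Fin.revPerm

theorem pos_rv (w : W) (i : Nat) : pos (rv w) i = 7 - pos w i := by
  have : (rv w).symm (Fin.ofNat 8 i) = Fin.rev (w.symm (Fin.ofNat 8 i)) := by
    rw [Equiv.symm_apply_eq]; simp [rv]
  unfold pos
  rw [this, Fin.val_rev]; omega

theorem pos_fl (w : W) (i : Nat) (hi : i < 8) : pos (fl w) i = 7 - pos w (7 - i) := by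
  have : (fl w).symm (Fin.ofNat 8 i) = Fin.rev (w.symm (Fin.ofNat 8 (7 - i))) := by
    rw [Equiv.symm_apply_eq]; simp [fl]
    ext
    simp [Fin.val_rev]
    omega
  unfold pos
  rw [this, Fin.val_rev]; omega

theorem iv_rv (w : W) (i j : Nat) (hij : i < j) (hj : j < 8) : iv (rv w) i j = !iv w i j := by
  have h1 := pos_lt w i
  have h2 := pos_lt w j
  have h3 : pos w i ≠ pos w j := fun h => by
    have := pos_inj w (by omega) hj h
    omega
  unfold iv
  rw [pos_rv, pos_rv, ← decide_not, decide_eq_decide]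
  omega

theorem iv_fl (w : W) (i j : Nat) (hij : i < j) (hj : j < 8) : iv (fl w) i j = iv w (7 - j) (7 - i) := by
  have h1 := pos_lt w (7 - i)
  have h2 := pos_lt w (7 - j)
  unfold iv
  rw [pos_fl w i (by omega), pos_fl w j hj, decide_eq_decide]
  omega

theorem s1_tbl : ∀ l < 224, s1 l < 224 ∧ s1 l / 4 = l / 4 ∧
    decide (bAB (s1 l % 4) = 1) = !decide (bAB (l % 4) = 1) ∧
    decide (bAC (s1 l % 4) = 1) = !decide (bAC (l % 4) = 1) ∧
    decide (bBC (s1 l % 4) = 1) = !decide (bBC (l % 4) = 1) := by decide +kernel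

theorem s2_tbl : ∀ l < 224, s2 l < 224 ∧ nth TA (s2 l / 4) = 7 - nth TC (l / 4) ∧
    nth TB (s2 l / 4) = 7 - nth TB (l / 4) ∧ nth TC (s2 l / 4) = 7 - nth TA (l / 4) ∧
    bAB (s2 l % 4) = bBC (l % 4) ∧ bAC (s2 l % 4) = bAC (l % 4) ∧ bBC (s2 l % 4) = bAB (l % 4) := by
  decide +kernel

theorem hp_rv (w : W) (l : Nat) (h : hp (rv w) l) : hp w (s1 l) := by
  obtain ⟨hl, a, b, c⟩ := h
  obtain ⟨h1, h2, h3, h4, h5⟩ := s1_tbl l hl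
  obtain ⟨t1, t2, t3⟩ := tbl_lt (l / 4) (by omega)
  rw [iv_rv _ _ _ (by omega) (by omega)] at a b c
  refine ⟨h1, ?_, ?_, ?_⟩
  · rw [h2, h3, ← a, Bool.not_not]
  · rw [h2, h4, ← b, Bool.not_not]
  · rw [h2, h5, ← c, Bool.not_not]

theorem hp_fl (w : W) (l : Nat) (h : hp (fl w) l) : hp w (s2 l) := by
  obtain ⟨hl, a, b, c⟩ := h
  obtain ⟨h1, h2, h3, h4, h5, h6, h7⟩ := s2_tbl l hl
  obtain ⟨t1, t2, t3⟩ := tbl_lt (l / 4) (by omega)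
  rw [iv_fl _ _ _ (by omega) (by omega)] at a b c
  refine ⟨h1, ?_, ?_, ?_⟩
  · rw [h2, h3, h5, ← c]
  · rw [h2, h4, h6, ← b]
  · rw [h3, h4, h7, ← a]

theorem Bnd_sym (g : Nat → Nat) (φ : W → W) (hi : Function.Injective φ) (hφ : ∀ w l, hp (φ w) l → hp w (g l))
    (hg : ∀ o < 112, (g (2 * o) = 2 * (g (2 * o) / 2) ∧ g (2 * o + 1) = 2 * (g (2 * o) / 2) + 1) ∨
      (g (2 * o + 1) = 2 * (g (2 * o) / 2) ∧ g (2 * o) = 2 * (g (2 * o) / 2) + 1))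
    (T : List Nat) (h : Bnd T) : Bnd (T.map g) := by
  classical
  intro D hD hL
  have := h (D.image φ) ?_ ?_
  · rwa [Finset.card_image_of_injective _ hi] at this
  · intro w hw v hv o hh
    obtain ⟨w, hw', rfl⟩ := Finset.mem_image.1 hw
    obtain ⟨v, hv', rfl⟩ := Finset.mem_image.1 hv
    obtain ⟨h1, h2⟩ := hh
    have ho : o < 112 := by
      have := h1.1
      omega
    have h1 := hφ _ _ h1
    have h2 := hφ _ _ h2
    rcases hg o ho with ⟨e1, e2⟩ | ⟨e1, e2⟩
    · rw [e1] at h1; rw [e2] at h2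
      exact hD w hw' v hv' _ ⟨h1, h2⟩
    · rw [e2] at h1; rw [e1] at h2
      exact hD v hv' w hw' _ ⟨h2, h1⟩
  · intro w hw l hl hh
    obtain ⟨w, hw', rfl⟩ := Finset.mem_image.1 hw
    exact hL w hw' (g l) (List.mem_map_of_mem hl) (hφ _ _ hh)

theorem Bnd_s1 (T : List Nat) (h : Bnd T) : Bnd (T.map s1) :=
  Bnd_sym s1 rv (fun _ _ h => mul_right_cancel h) hp_rv (by decide +kernel) T h

theorem Bnd_s2 (T : List Nat) (h : Bnd T) : Bnd (T.map s2) :=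
  Bnd_sym s2 fl (fun _ _ h => mul_left_cancel (mul_right_cancel h)) hp_fl (by decide +kernel) T h

def sub (T L : List Nat) : Bool := T.all (fun l => L.contains l)

theorem Bnd_sub {T L : List Nat} (h : sub T L = true) (b : Bnd T) : Bnd L := by
  refine Bnd_mono ?_ b
  intro l hl
  have := List.all_eq_true.1 h l hl
  simpa using this

/-- top of the search tree, using the symmetries -/
def tchk (Ts : List (List Nat)) : Tr → List Nat → Bool
  | .l, L => Ts.any (fun T => sub T L || sub (T.map s1) L || sub (T.map s2) L || sub ((T.map s1).map s2) L)
  | .n o a b, L => tchk Ts a ((2 * o) :: L) && tchk Ts b ((2 * o + 1) :: L)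

theorem tchk_spec (Ts : List (List Nat)) (hT : ∀ T ∈ Ts, Bnd T) (t : Tr) : ∀ L, tchk Ts t L = true → Bnd L := by
  induction t with
  | l =>
    intro L h
    obtain ⟨T, hm, h⟩ := List.any_eq_true.1 h
    have hb := hT T hm
    simp only [Bool.or_eq_true] at h
    rcases h with ((h | h) | h) | h
    · exact Bnd_sub h hb
    · exact Bnd_sub h (Bnd_s1 _ hb)
    · exact Bnd_sub h (Bnd_s2 _ hb)
    · exact Bnd_sub h (Bnd_s2 _ (Bnd_s1 _ hb))
  | n o a b iha ihb =>
    intro L h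
    rw [tchk, Bool.and_eq_true] at h
    exact Bnd_branch o (iha _ h.1) (ihb _ h.2)

/-! Reduction of the statement -/

theorem cond_perm {D : Set W} (hD : IsCondorcet 8 D) (a b c : Fin 8) (hab : a ≠ b) (hac : a ≠ c) (hbc : b ≠ c) :
    ∃ x ∈ ({a, b, c} : Finset (Fin 8)), ∃ i ∈ ({1, 2, 3} : Finset ℕ), ∀ w ∈ D, tripleRank w a b c x ≠ i := by
  have key : ∀ a' b' c' : Fin 8, a' < b' → b' < c' → ({a', b', c'} : Finset (Fin 8)) = {a, b, c} →
      ∃ x ∈ ({a, b, c} : Finset (Fin 8)), ∃ i ∈ ({1, 2, 3} : Finset ℕ), ∀ w ∈ D, tripleRank w a b c x ≠ i := by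
    intro a' b' c' h1 h2 e
    have := hD a' b' c' h1 h2
    unfold tripleRank at this ⊢
    rwa [e] at this
  rcases lt_or_gt_of_ne hab with h1 | h1 <;> rcases lt_or_gt_of_ne hac with h2 | h2 <;>
    rcases lt_or_gt_of_ne hbc with h3 | h3
  · exact key a b c h1 h3 rfl
  · exact key a c b h2 h3 (by ext; simp; tauto)
  · exact absurd (h1.trans h3) (not_lt_of_gt h2)
  · exact key c a b h2 h1 (by ext; simp; tauto)
  · exact key b a c h1 h2 (by ext; simp; tauto)
  · exact absurd (h2.trans h3) (not_lt_of_gt h1)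
  · exact key b c a h3 h2 (by ext; simp; tauto)
  · exact key c b a h3 h1 (by ext; simp; tauto)

/-- rank from the positions -/
theorem rank_eq (w : W) (a b c x : Fin 8) (hab : a ≠ b) (hac : a ≠ c) (hbc : b ≠ c) : tripleRank w a b c x =
    (if w.symm a ≤ w.symm x then 1 else 0) + (if w.symm b ≤ w.symm x then 1 else 0) +
      (if w.symm c ≤ w.symm x then 1 else 0) := by
  unfold tripleRank
  rw [Finset.card_filter, Finset.sum_insert (by simp [hab, hac]), Finset.sum_insert (by simp [hbc]),
    Finset.sum_singleton, add_assoc]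

theorem no_opp {D : Set W} (hD : IsCondorcet 8 D) (a b c : Fin 8) (hab : a ≠ b) (hac : a ≠ c) (hbc : b ≠ c)
    (p q r s : W) (hp : p ∈ D) (hq : q ∈ D) (hr : r ∈ D) (hs : s ∈ D)
    (p1 : p.symm a < p.symm b) (p2 : p.symm b < p.symm c)
    (q1 : q.symm c < q.symm b) (q2 : q.symm b < q.symm a)
    (h : (r.symm a < r.symm c ∧ r.symm c < r.symm b ∧ s.symm b < s.symm a ∧ s.symm a < s.symm c) ∨
      (r.symm b < r.symm c ∧ r.symm c < r.symm a ∧ s.symm c < s.symm a ∧ s.symm a < s.symm b)) : False := by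
  obtain ⟨x, hx, i, hi, H⟩ := cond_perm hD a b c hab hac hbc
  have Hp := H p hp
  have Hq := H q hq
  have Hr := H r hr
  have Hs := H s hs
  rw [rank_eq _ _ _ _ _ hab hac hbc] at Hp Hq Hr Hs
  simp only [Finset.mem_insert, Finset.mem_singleton] at hx hi
  have key : ∀ (w : W) (x y z : Fin 8), w.symm x < w.symm y → w.symm y < w.symm z →
      w.symm x ≤ w.symm y ∧ w.symm x ≤ w.symm z ∧ w.symm y ≤ w.symm z ∧ ¬ w.symm y ≤ w.symm x ∧
      ¬ w.symm z ≤ w.symm x ∧ ¬ w.symm z ≤ w.symm y := fun w x y z h1 h2 =>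
    ⟨h1.le, (h1.trans h2).le, h2.le, h1.not_ge, (h1.trans h2).not_ge, h2.not_ge⟩
  have kp := key _ _ _ _ p1 p2
  have kq := key _ _ _ _ q1 q2
  rcases h with ⟨h1, h2, h3, h4⟩ | ⟨h1, h2, h3, h4⟩
  · have kr := key _ _ _ _ h1 h2
    have ks := key _ _ _ _ h3 h4
    rcases hx with rfl | rfl | rfl <;> simp only [kp, kq, kr, ks, le_refl, if_true, if_false] at Hp Hq Hr Hs <;> omega
  · have kr := key _ _ _ _ h1 h2
    have ks := key _ _ _ _ h3 h4
    rcases hx with rfl | rfl | rfl <;> simp only [kp, kq, kr, ks, le_refl, if_true, if_false] at Hp Hq Hr Hs <;> omega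

theorem cond_bound (hB : Bnd []) (D : Set W) (hD : IsCondorcet 8 D) (hrev : ∃ w ∈ D, reverseOrder w ∈ D) :
    D.ncard ≤ 222 := by
  classical
  obtain ⟨w0, h0, h1⟩ := hrev
  have hfin : D.Finite := Set.toFinite D
  rw [Set.ncard_eq_toFinset_card D hfin]
  have hinj : Function.Injective (fun w : W => w0⁻¹ * w) := fun _ _ h => mul_left_cancel h
  rw [← Finset.card_image_of_injective _ hinj]
  apply hB
  · intro w hw v hv o hh
    obtain ⟨w, hw, rfl⟩ := Finset.mem_image.1 hw
    obtain ⟨v, hv, rfl⟩ := Finset.mem_image.1 hv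
    have hw : w ∈ D := by simpa using hw
    have hv : v ∈ D := by simpa using hv
    obtain ⟨⟨hl, a1, a2, a3⟩, ⟨hl', b1, b2, b3⟩⟩ := hh
    obtain ⟨t1, t2, t3⟩ := tbl_lt (2 * o / 4) (by omega)
    rw [show (2 * o + 1) / 4 = 2 * o / 4 by omega] at b1 b2 b3
    generalize nth TA (2 * o / 4) = a at *
    generalize nth TB (2 * o / 4) = b at *
    generalize nth TC (2 * o / 4) = c at *
    have hpos : ∀ (w : W) (i : Nat), pos (w0⁻¹ * w) i = (w.symm (w0 (Fin.ofNat 8 i))).val := by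
      intro w i
      have : (w0⁻¹ * w).symm (Fin.ofNat 8 i) = w.symm (w0 (Fin.ofNat 8 i)) := by
        rw [Equiv.symm_apply_eq]; simp
      unfold pos
      rw [this]
    unfold iv at a1 a2 a3 b1 b2 b3
    rw [hpos, hpos] at a1 a2 a3 b1 b2 b3
    have e : ∀ i j : Nat, i < 8 → j < 8 → i ≠ j → w0 (Fin.ofNat 8 i) ≠ w0 (Fin.ofNat 8 j) := by
      intro i j hi hj hij h
      have := congrArg Fin.val (w0.injective h)
      simp [Fin.ofNat, Nat.mod_eq_of_lt hi, Nat.mod_eq_of_lt hj] at this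
      exact hij this
    have hab := e a b (by omega) (by omega) (by omega)
    have hac := e a c (by omega) (by omega) (by omega)
    have hbc := e b c (by omega) (by omega) (by omega)
    have q0 : ∀ i : Nat, i < 8 → (w0.symm (w0 (Fin.ofNat 8 i))).val = i := by
      intro i hi
      simp [Nat.mod_eq_of_lt hi]
    have q1 : ∀ i : Nat, i < 8 → ((reverseOrder w0).symm (w0 (Fin.ofNat 8 i))).val = 7 - i := by
      intro i hi
      have : (reverseOrder w0).symm (w0 (Fin.ofNat 8 i)) = Fin.rev (Fin.ofNat 8 i) := by
        rw [Equiv.symm_apply_eq]; simp [reverseOrder]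
      rw [this, Fin.val_rev]
      simp [Nat.mod_eq_of_lt hi]
    have n1 : ∀ (w : W) {x y : Fin 8}, x ≠ y → (w.symm x).val ≠ (w.symm y).val :=
      fun w x y h h' => h (w.symm.injective (Fin.ext h'))
    have d1 := n1 w hab
    have d2 := n1 w hac
    have d3 := n1 w hbc
    have d4 := n1 v hab
    have d5 := n1 v hac
    have d6 := n1 v hbc
    refine no_opp hD _ _ _ hab hac hbc w0 (reverseOrder w0) w v h0 h1 hw hv ?_ ?_ ?_ ?_ ?_
    · rw [Fin.lt_def, q0 _ (by omega), q0 _ (by omega)]; omega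
    · rw [Fin.lt_def, q0 _ (by omega), q0 _ (by omega)]; omega
    · rw [Fin.lt_def, q1 _ (by omega), q1 _ (by omega)]; omega
    · rw [Fin.lt_def, q1 _ (by omega), q1 _ (by omega)]; omega
    · simp only [Fin.lt_def]
      have hm : (2 * o % 4 = 0 ∧ (2 * o + 1) % 4 = 1) ∨ (2 * o % 4 = 2 ∧ (2 * o + 1) % 4 = 3) := by omega
      rcases hm with ⟨m1, m2⟩ | ⟨m1, m2⟩
      · rw [m1] at a1 a2 a3
        rw [m2] at b1 b2 b3
        simp only [bAB, bAC, bBC, nth0, nth1, nth2, nth3, decide_eq_decide, decide_eq_false_iff_not, decide_eq_true_eq, decide_true, decide_false, zero_ne_one, not_lt] at a1 a2 a3 b1 b2 b3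
        left; omega
      · rw [m1] at a1 a2 a3
        rw [m2] at b1 b2 b3
        simp only [bAB, bAC, bBC, nth0, nth1, nth2, nth3, decide_eq_decide, decide_eq_false_iff_not, decide_eq_true_eq, decide_true, decide_false, zero_ne_one, not_lt] at a1 a2 a3 b1 b2 b3
        right; omega
  · intro w _ l hl
    simp at hl

end CD8
namespace CD8

noncomputable def allc (u : List Nat) (its : List (List Nat × Tr)) : Bool :=
  List.rec true (fun it _ ih => Bool.rec false ih (chk u it.2 (rems u (U u) it.1))) its

noncomputable def full (u : List Nat) (its : List (List Nat × Tr)) : Bool :=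
  Bool.rec false (allc u its) (dfs u 7 255 (U u) 0)

theorem allc_spec (u : List Nat) (its : List (List Nat × Tr)) (h : allc u its = true) :
    ∀ it ∈ its, chk u it.2 (rems u (U u) it.1) = true := by
  induction its with
  | nil => simp
  | cons k l ih =>
    change (Bool.rec false (allc u l) (chk u k.2 (rems u (U u) k.1)) : Bool) = true at h
    cases hg : chk u k.2 (rems u (U u) k.1) with
    | false => rw [hg] at h; simp at h
    | true =>
      rw [hg] at h
      intro k' hk'
      rcases List.mem_cons.1 hk' with rfl | hk'
      · exact hg
      · exact ih h k' hk'

def lits (u : List Nat) (its : List (List Nat × Tr)) : List (List Nat) := its.map (fun it => List.tail u ++ it.1)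

theorem full_spec (u : List Nat) (its : List (List Nat × Tr)) (hls : ∀ l ∈ List.tail u, l < 224)
    (h : full u its = true) : ∀ T ∈ lits u its, Bnd T := by
  intro T hT
  obtain ⟨it, hit, rfl⟩ := List.mem_map.1 hT
  unfold full at h
  cases hd : dfs u 7 255 (U u) 0 with
  | false => rw [hd] at h; simp at h
  | true =>
    rw [hd] at h
    exact Bnd_of_check u it.1 it.2 hls hd (allc_spec u its h it hit)

def u0 : List Nat := [16800, 16, 18, 141, 143]
def t0 : List (List Nat × Tr) :=
    [([24, 26, 213, 215], .n 85 .l .l), ([25, 26, 213, 215], .n 0 .l .l), ([25, 27, 213, 215], .n 81 .l .l), ([25,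
    26, 212, 215], .n 96 (.n 0 (.n 110 .l .l) .l) (.n 110 .l (.n 0 .l .l))), ([24, 27, 212, 215], .n 22 (.n 93 (.n
    1 .l .l) .l) (.n 1 (.n 110 .l .l) .l)), ([25, 27, 212, 215], .n 75 (.n 110 .l (.n 93 .l .l)) (.n 110 .l .l)),
    ([25, 27, 212, 214], .n 54 .l (.n 17 .l (.n 6 .l .l)))]

def u1 : List Nat := [20160, 17, 19, 140, 142]
def t1 : List (List Nat × Tr) :=
    [([96, 98, 133, 135], .n 56 .l .l), ([97, 98, 133, 135], .n 83 .l (.n 73 .l .l)), ([97, 99, 133, 135], .n 56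
    .l .l), ([97, 98, 132, 135], .n 77 (.n 62 .l .l) (.n 55 (.n 62 .l .l) (.n 94 .l (.n 7 .l .l)))), ([96, 99,
    132, 135], .n 55 (.n 69 (.n 93 .l .l) (.n 17 (.n 93 .l .l) (.n 62 (.n 93 .l .l) .l))) (.n 26 (.n 13 (.n 82 .l
    .l) (.n 74 .l .l)) (.n 82 .l .l))), ([97, 99, 132, 135], .n 61 .l .l), ([97, 99, 132, 134], .n 87 .l .l)]

def u2 : List Nat := [8848, 17, 18, 141, 143, 130, 214]
def t2 : List (List Nat × Tr) :=
    [([], .n 14 (.n 24 (.n 92 .l (.n 63 (.n 13 .l .l) .l)) (.n 111 .l .l)) (.n 57 (.n 79 (.n 99 .l .l) .l) (.n 98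
    .l (.n 43 .l .l))))]

def u3 : List Nat := [8512, 17, 18, 141, 143, 130, 215]
def t3 : List (List Nat × Tr) :=
    [([], .n 22 (.n 75 (.n 98 (.n 17 .l .l) .l) (.n 98 (.n 47 .l .l) (.n 43 .l .l))) (.n 18 (.n 55 (.n 82 .l .l)
    .l) (.n 55 (.n 12 .l .l) .l)))]

def u4 : List Nat := [9072, 17, 18, 141, 143, 131, 106]
def t4 : List (List Nat × Tr) :=
    [([], .n 106 (.n 110 (.n 45 .l .l) (.n 12 (.n 82 .l .l) (.n 61 .l .l))) (.n 16 (.n 59 (.n 74 .l (.n 109 (.n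
    101 .l .l) (.n 101 .l .l))) (.n 111 .l (.n 36 .l .l))) (.n 89 (.n 74 .l (.n 45 .l .l)) (.n 81 .l (.n 51 .l
    .l)))))]

def u5 : List Nat := [10752, 17, 18, 141, 143, 131, 107]
def t5 : List (List Nat × Tr) :=
    [([], .n 43 (.n 102 (.n 87 .l .l) (.n 49 (.n 98 .l .l) (.n 104 (.n 94 .l .l) .l))) (.n 78 (.n 102 (.n 91 .l
    (.n 69 .l .l)) (.n 94 (.n 104 .l .l) (.n 89 .l .l))) (.n 103 (.n 107 (.n 67 .l .l) (.n 100 .l .l)) (.n 102 (.n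
    99 .l .l) (.n 67 .l .l)))))]

def u6 : List Nat := [9408, 17, 19, 141, 143, 96, 98]
def t6 : List (List Nat × Tr) :=
    [([], .n 98 (.n 95 .l .l) (.n 99 .l .l))]

def u7 : List Nat := [10752, 17, 19, 141, 143, 97, 98]
def t7 : List (List Nat × Tr) :=
    [([], .n 87 (.n 92 (.n 62 .l (.n 77 .l .l)) (.n 83 (.n 54 .l .l) .l)) (.n 66 (.n 81 (.n 75 .l .l) (.n 73 .l
    .l)) (.n 19 (.n 75 .l (.n 81 .l .l)) (.n 81 .l .l))))]

def u8 : List Nat := [12096, 17, 19, 141, 143, 97, 99]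
def t8 : List (List Nat × Tr) :=
    [([], .n 85 (.n 90 (.n 83 (.n 109 .l (.n 105 .l .l)) .l) (.n 57 .l (.n 1 .l (.n 86 .l .l)))) (.n 78 (.n 62 .l
    (.n 100 .l .l)) (.n 5 .l (.n 14 .l (.n 73 .l .l)))))]

def u9 : List Nat := [10080, 17, 18, 140, 143, 98, 135]
def t9 : List (List Nat × Tr) :=
    [([], .n 55 (.n 12 (.n 83 .l .l) (.n 77 (.n 34 (.n 61 .l (.n 43 .l .l)) (.n 97 (.n 22 .l .l) .l)) (.n 83 .l
    .l))) (.n 96 (.n 83 .l (.n 104 (.n 105 .l .l) (.n 73 .l .l))) (.n 83 (.n 99 (.n 45 .l (.n 61 .l .l)) (.n 14 .l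
    (.n 98 .l .l))) (.n 61 .l .l))))]

def u10 : List Nat := [7560, 17, 18, 140, 143, 99, 135, 122]
def t10 : List (List Nat × Tr) :=
    [([], .n 76 (.n 25 (.n 77 (.n 63 .l .l) .l) (.n 98 (.n 13 (.n 63 .l .l) (.n 63 .l .l)) (.n 13 (.n 87 .l .l)
    .l))) (.n 22 (.n 99 .l (.n 110 (.n 57 .l (.n 98 .l .l)) .l)) (.n 77 (.n 110 (.n 55 (.n 14 (.n 95 (.n 17 .l (.n
    37 .l (.n 53 .l .l))) .l) .l) .l) (.n 63 (.n 55 .l .l) .l)) .l)))]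

def u11 : List Nat := [9408, 17, 18, 140, 143, 99, 135, 123]
def t11 : List (List Nat × Tr) :=
    [([], .n 78 (.n 100 (.n 75 (.n 104 (.n 82 (.n 53 .l .l) (.n 53 .l .l)) (.n 95 .l .l)) (.n 92 (.n 74 .l .l) (.n
    98 (.n 93 .l .l) .l))) (.n 92 (.n 91 .l .l) (.n 53 .l (.n 91 .l .l)))) (.n 57 (.n 106 (.n 20 (.n 86 (.n 81 .l
    .l) .l) .l) (.n 95 .l (.n 15 .l .l))) (.n 20 (.n 86 .l (.n 80 .l .l)) (.n 91 .l .l))))]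

def u12 : List Nat := [7784, 17, 18, 140, 143, 99, 134, 148]
def t12 : List (List Nat × Tr) :=
    [([], .n 88 (.n 77 (.n 95 .l .l) (.n 16 .l .l)) (.n 77 (.n 92 (.n 72 (.n 95 .l .l) (.n 69 (.n 20 (.n 33 .l (.n
    23 (.n 90 (.n 82 .l .l) .l) .l)) .l) .l)) (.n 57 .l (.n 65 (.n 76 (.n 109 .l .l) .l) .l))) (.n 16 (.n 76 (.n
    94 (.n 102 .l .l) (.n 30 (.n 84 (.n 63 .l .l) .l) (.n 61 (.n 13 .l .l) .l))) (.n 30 (.n 95 .l .l) .l)) (.n 96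
    .l .l))))]

def u13 : List Nat := [7784, 17, 18, 140, 143, 99, 134, 149]
def t13 : List (List Nat × Tr) :=
    [([], .n 30 (.n 57 (.n 63 (.n 53 (.n 84 .l (.n 7 .l .l)) .l) (.n 88 (.n 95 .l .l) (.n 33 (.n 55 .l .l) (.n 59
    (.n 24 .l (.n 82 (.n 15 .l (.n 55 (.n 83 .l (.n 2 .l .l)) .l)) .l)) (.n 15 .l .l))))) (.n 95 .l (.n 27 (.n 18
    (.n 84 .l .l) .l) .l))) (.n 88 (.n 95 (.n 55 .l .l) .l) (.n 55 (.n 63 (.n 4 .l (.n 69 (.n 60 .l (.n 44 .l .l))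
    .l)) .l) (.n 20 (.n 54 (.n 22 (.n 61 .l .l) .l) (.n 95 .l .l)) .l))))]

def u14 : List Nat := [8064, 16, 19, 140, 143, 38, 137]
def t14 : List (List Nat × Tr) :=
    [([], .n 92 (.n 87 (.n 83 (.n 58 .l (.n 24 .l (.n 60 .l (.n 12 .l (.n 93 .l .l))))) (.n 16 (.n 23 (.n 74 .l
    .l) .l) (.n 60 (.n 46 .l (.n 95 (.n 52 .l .l) (.n 56 .l (.n 79 (.n 101 .l .l) .l)))) .l))) (.n 75 .l .l)) (.n
    44 (.n 54 .l .l) (.n 81 (.n 87 (.n 74 (.n 80 .l (.n 77 .l (.n 58 .l .l))) .l) .l) (.n 83 (.n 58 (.n 57 .l .l)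
    .l) .l))))]

def u15 : List Nat := [8232, 16, 19, 140, 143, 39, 137]
def t15 : List (List Nat × Tr) :=
    [([], .n 78 (.n 46 (.n 57 (.n 80 .l .l) (.n 94 .l (.n 43 .l (.n 100 .l .l)))) (.n 92 .l .l)) (.n 44 (.n 27 (.n
    101 (.n 92 (.n 63 (.n 60 .l .l) .l) .l) (.n 60 .l .l)) .l) (.n 60 (.n 45 (.n 99 .l .l) .l) .l)))]

def u16 : List Nat := [8736, 16, 19, 140, 143, 39, 136]
def t16 : List (List Nat × Tr) :=
    [([], .n 52 (.n 84 (.n 25 .l (.n 60 .l .l)) (.n 57 (.n 99 .l .l) (.n 98 .l .l))) (.n 42 (.n 27 (.n 82 (.n 83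
    .l .l) (.n 95 (.n 87 .l .l) .l)) .l) (.n 83 .l .l)))]

def u17 : List Nat := [10080, 17, 19, 140, 143, 98, 174]
def t17 : List (List Nat × Tr) :=
    [([], .n 83 (.n 46 (.n 64 (.n 74 .l .l) (.n 107 (.n 74 .l .l) .l)) (.n 68 (.n 77 (.n 81 .l .l) .l) (.n 80 (.n
    73 .l (.n 85 (.n 52 .l .l) .l)) (.n 107 (.n 77 .l .l) (.n 54 .l .l))))) (.n 50 (.n 88 .l .l) (.n 54 (.n 73 .l
    (.n 96 (.n 95 .l (.n 6 .l .l)) .l)) (.n 6 (.n 75 (.n 19 .l .l) .l) .l))))]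

def u18 : List Nat := [9576, 17, 19, 140, 143, 98, 175]
def t18 : List (List Nat × Tr) :=
    [([], .n 50 (.n 96 (.n 61 (.n 75 .l .l) .l) (.n 75 .l .l)) (.n 67 (.n 60 (.n 75 .l .l) (.n 75 .l (.n 19 .l
    .l))) (.n 75 (.n 10 (.n 93 .l .l) .l) (.n 94 .l (.n 85 .l (.n 55 .l .l))))))]

def u19 : List Nat := [9744, 17, 19, 140, 143, 99, 134]
def t19 : List (List Nat × Tr) :=
    [([], .n 54 (.n 68 (.n 55 .l (.n 92 .l .l)) (.n 78 (.n 10 (.n 92 .l .l) (.n 92 .l .l)) (.n 63 .l .l))) (.n 68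
    (.n 95 .l (.n 55 .l .l)) (.n 10 (.n 84 (.n 42 .l .l) (.n 95 .l .l)) (.n 84 (.n 42 .l .l) .l))))]

def u20 : List Nat := [11088, 17, 19, 140, 143, 99, 135]
def t20 : List (List Nat × Tr) :=
    [([], .n 61 (.n 52 (.n 76 (.n 87 .l (.n 98 .l .l)) (.n 50 (.n 84 .l .l) .l)) (.n 64 .l (.n 10 .l .l))) (.n 78
    (.n 62 (.n 53 .l .l) (.n 0 .l (.n 100 .l .l))) (.n 104 (.n 4 .l (.n 53 .l .l)) (.n 93 .l (.n 6 .l (.n 55 .l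
    .l))))))]

set_option maxHeartbeats 0 in
theorem call : full u0 t0 = true ∧
    full u1 t1 = true ∧
    full u2 t2 = true ∧
    full u3 t3 = true ∧
    full u4 t4 = true ∧
    full u5 t5 = true ∧
    full u6 t6 = true ∧
    full u7 t7 = true ∧
    full u8 t8 = true ∧
    full u9 t9 = true ∧
    full u10 t10 = true ∧
    full u11 t11 = true ∧
    full u12 t12 = true ∧
    full u13 t13 = true ∧
    full u14 t14 = true ∧
    full u15 t15 = true ∧
    full u16 t16 = true ∧
    full u17 t17 = true ∧
    full u18 t18 = true ∧
    full u19 t19 = true ∧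
    full u20 t20 = true := by
  refine ⟨?_, ?_, ?_, ?_, ?_, ?_, ?_, ?_, ?_, ?_, ?_, ?_, ?_, ?_, ?_, ?_, ?_, ?_, ?_, ?_, ?_⟩ <;> decide +kernel

theorem c0 : full u0 t0 = true := call.1

theorem c1 : full u1 t1 = true := call.2.1

theorem c2 : full u2 t2 = true := call.2.2.1

theorem c3 : full u3 t3 = true := call.2.2.2.1

theorem c4 : full u4 t4 = true := call.2.2.2.2.1

theorem c5 : full u5 t5 = true := call.2.2.2.2.2.1

theorem c6 : full u6 t6 = true := call.2.2.2.2.2.2.1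

theorem c7 : full u7 t7 = true := call.2.2.2.2.2.2.2.1

theorem c8 : full u8 t8 = true := call.2.2.2.2.2.2.2.2.1

theorem c9 : full u9 t9 = true := call.2.2.2.2.2.2.2.2.2.1

theorem c10 : full u10 t10 = true := call.2.2.2.2.2.2.2.2.2.2.1

theorem c11 : full u11 t11 = true := call.2.2.2.2.2.2.2.2.2.2.2.1

theorem c12 : full u12 t12 = true := call.2.2.2.2.2.2.2.2.2.2.2.2.1

theorem c13 : full u13 t13 = true := call.2.2.2.2.2.2.2.2.2.2.2.2.2.1

theorem c14 : full u14 t14 = true := call.2.2.2.2.2.2.2.2.2.2.2.2.2.2.1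

theorem c15 : full u15 t15 = true := call.2.2.2.2.2.2.2.2.2.2.2.2.2.2.2.1

theorem c16 : full u16 t16 = true := call.2.2.2.2.2.2.2.2.2.2.2.2.2.2.2.2.1

theorem c17 : full u17 t17 = true := call.2.2.2.2.2.2.2.2.2.2.2.2.2.2.2.2.2.1

theorem c18 : full u18 t18 = true := call.2.2.2.2.2.2.2.2.2.2.2.2.2.2.2.2.2.2.1

theorem c19 : full u19 t19 = true := call.2.2.2.2.2.2.2.2.2.2.2.2.2.2.2.2.2.2.2.1

theorem c20 : full u20 t20 = true := call.2.2.2.2.2.2.2.2.2.2.2.2.2.2.2.2.2.2.2.2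

def Ts : List (List Nat) := lits u0 t0 ++ lits u1 t1 ++ lits u2 t2 ++ lits u3 t3 ++ lits u4 t4 ++ lits u5 t5 ++ lits u6 t6 ++ lits u7 t7 ++ lits u8 t8 ++ lits u9 t9 ++ lits u10 t10 ++ lits u11 t11 ++ lits u12 t12 ++ lits u13 t13 ++ lits u14 t14 ++ lits u15 t15 ++ lits u16 t16 ++ lits u17 t17 ++ lits u18 t18 ++ lits u19 t19 ++ lits u20 t20
def topTree : Tr :=
    .n 8 (.n 9 (.n 70 (.n 71 (.n 66 (.n 67 .l .l) (.n 67 .l .l)) (.n 27 (.n 95 .l .l) (.n 13 .l .l))) (.n 71 (.n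
    26 (.n 94 .l .l) (.n 12 .l .l)) (.n 106 (.n 107 (.n 12 (.n 13 .l .l) (.n 13 .l .l)) (.n 12 (.n 13 .l .l) (.n
    13 .l .l))) (.n 107 (.n 12 (.n 13 .l .l) (.n 13 .l .l)) (.n 12 (.n 13 .l .l) (.n 13 .l .l)))))) (.n 70 (.n 71
    (.n 66 (.n 48 .l .l) (.n 46 .l .l)) (.n 19 (.n 68 .l .l) (.n 68 .l .l))) (.n 71 (.n 48 (.n 66 (.n 76 .l .l)
    .l) (.n 66 (.n 75 .l .l) (.n 60 .l .l))) (.n 64 (.n 106 .l .l) (.n 52 .l .l))))) (.n 9 (.n 70 (.n 71 (.n 67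
    (.n 49 .l .l) (.n 47 .l .l)) (.n 49 (.n 67 (.n 77 .l .l) .l) (.n 67 (.n 74 .l .l) (.n 61 .l .l)))) (.n 71 (.n
    18 (.n 69 .l .l) (.n 69 .l .l)) (.n 65 (.n 107 .l .l) (.n 53 .l .l)))) (.n 70 (.n 71 (.n 48 (.n 49 (.n 66 (.n
    67 .l .l) (.n 67 .l .l)) (.n 66 (.n 67 .l .l) (.n 67 .l .l))) (.n 49 (.n 66 (.n 67 .l .l) (.n 67 .l .l)) (.n
    66 (.n 67 .l .l) (.n 67 .l .l)))) (.n 49 (.n 87 .l .l) (.n 67 .l .l))) (.n 71 (.n 48 (.n 86 .l .l) (.n 66 .l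
    .l)) (.n 48 (.n 49 .l .l) (.n 49 .l .l)))))

theorem top_ok : tchk Ts topTree [] = true := by decide +kernel

theorem app_ok {A B : List (List Nat)} (hA : ∀ T ∈ A, Bnd T) (hB : ∀ T ∈ B, Bnd T) : ∀ T ∈ A ++ B, Bnd T := by
  intro T hT
  rcases List.mem_append.1 hT with h | h
  · exact hA T h
  · exact hB T h

theorem d0 : ∀ T ∈ lits u0 t0, Bnd T := full_spec u0 t0 (by decide) c0
theorem d1 : ∀ T ∈ lits u1 t1, Bnd T := full_spec u1 t1 (by decide) c1
theorem d2 : ∀ T ∈ lits u2 t2, Bnd T := full_spec u2 t2 (by decide) c2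
theorem d3 : ∀ T ∈ lits u3 t3, Bnd T := full_spec u3 t3 (by decide) c3
theorem d4 : ∀ T ∈ lits u4 t4, Bnd T := full_spec u4 t4 (by decide) c4
theorem d5 : ∀ T ∈ lits u5 t5, Bnd T := full_spec u5 t5 (by decide) c5
theorem d6 : ∀ T ∈ lits u6 t6, Bnd T := full_spec u6 t6 (by decide) c6
theorem d7 : ∀ T ∈ lits u7 t7, Bnd T := full_spec u7 t7 (by decide) c7
theorem d8 : ∀ T ∈ lits u8 t8, Bnd T := full_spec u8 t8 (by decide) c8
theorem d9 : ∀ T ∈ lits u9 t9, Bnd T := full_spec u9 t9 (by decide) c9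
theorem d10 : ∀ T ∈ lits u10 t10, Bnd T := full_spec u10 t10 (by decide) c10
theorem d11 : ∀ T ∈ lits u11 t11, Bnd T := full_spec u11 t11 (by decide) c11
theorem d12 : ∀ T ∈ lits u12 t12, Bnd T := full_spec u12 t12 (by decide) c12
theorem d13 : ∀ T ∈ lits u13 t13, Bnd T := full_spec u13 t13 (by decide) c13
theorem d14 : ∀ T ∈ lits u14 t14, Bnd T := full_spec u14 t14 (by decide) c14
theorem d15 : ∀ T ∈ lits u15 t15, Bnd T := full_spec u15 t15 (by decide) c15
theorem d16 : ∀ T ∈ lits u16 t16, Bnd T := full_spec u16 t16 (by decide) c16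
theorem d17 : ∀ T ∈ lits u17 t17, Bnd T := full_spec u17 t17 (by decide) c17
theorem d18 : ∀ T ∈ lits u18 t18, Bnd T := full_spec u18 t18 (by decide) c18
theorem d19 : ∀ T ∈ lits u19 t19, Bnd T := full_spec u19 t19 (by decide) c19
theorem d20 : ∀ T ∈ lits u20 t20, Bnd T := full_spec u20 t20 (by decide) c20

theorem Ts_ok : ∀ T ∈ Ts, Bnd T := by
  unfold Ts
  exact (app_ok (app_ok (app_ok (app_ok (app_ok (app_ok (app_ok (app_ok (app_ok (app_ok (app_ok (app_ok (app_ok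
    (app_ok (app_ok (app_ok (app_ok (app_ok (app_ok (app_ok d0 d1) d2) d3) d4) d5) d6) d7) d8) d9) d10) d11) d12)
    d13) d14) d15) d16) d17) d18) d19) d20)

theorem bnd_nil : Bnd [] := tchk_spec Ts Ts_ok topTree [] top_ok

end CD8

/-- Every Condorcet domain on `X_8` containing some linear order together with its
reverse has at most 222 elements. -/
theorem stmt4 (D : Set (Equiv.Perm (Fin 8))) (hD : IsCondorcet 8 D)
    (hrev : ∃ w ∈ D, reverseOrder w ∈ D) :
    D.ncard ≤ 222 := CD8.cond_bound CD8.bnd_nil D hD hrev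
end

section
/- The domain D224 is copious: for every triple a < b < c of elements of {1,...,8}, the set of restrictions of the orders in D224 to {a,b,c} consists of exactly 4 distinct linear orders on {a,b,c}. -/
/-- The rank pattern of `w` on the triple `(a, b, c)`. -/
def ranks (a b c : Fin 8) (w : Equiv.Perm (Fin 8)) : ℕ × ℕ × ℕ :=
  (tripleRank w a b c a, tripleRank w a b c b, tripleRank w a b c c)

/-- Thirteen orders of `D224` that realize all restrictions to triples. -/
def witnesses : List (Equiv.Perm (Fin 8)) :=
  [
   ⟨![0, 1, 2, 3, 4, 5, 6, 7], ![0, 1, 2, 3, 4, 5, 6, 7], by decide, by decide⟩,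
   ⟨![2, 1, 4, 0, 7, 3, 6, 5], ![3, 1, 0, 5, 2, 7, 6, 4], by decide, by decide⟩,
   ⟨![3, 0, 5, 6, 1, 2, 7, 4], ![1, 4, 5, 0, 7, 2, 3, 6], by decide, by decide⟩,
   ⟨![0, 3, 4, 7, 1, 2, 5, 6], ![0, 4, 5, 1, 2, 6, 7, 3], by decide, by decide⟩,
   ⟨![1, 2, 5, 6, 0, 3, 4, 7], ![4, 0, 1, 5, 6, 2, 3, 7], by decide, by decide⟩,
   ⟨![1, 0, 3, 5, 2, 4, 7, 6], ![1, 0, 4, 2, 5, 3, 7, 6], by decide, by decide⟩,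
   ⟨![1, 2, 4, 7, 0, 3, 5, 6], ![4, 0, 1, 5, 2, 6, 7, 3], by decide, by decide⟩,
   ⟨![0, 1, 2, 4, 3, 5, 6, 7], ![0, 1, 2, 4, 3, 5, 6, 7], by decide, by decide⟩,
   ⟨![0, 1, 2, 5, 3, 4, 6, 7], ![0, 1, 2, 4, 5, 3, 6, 7], by decide, by decide⟩,
   ⟨![0, 1, 3, 4, 2, 5, 6, 7], ![0, 1, 4, 2, 3, 5, 6, 7], by decide, by decide⟩,
   ⟨![0, 3, 4, 1, 7, 2, 5, 6], ![0, 3, 5, 1, 2, 6, 7, 4], by decide, by decide⟩,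
   ⟨![0, 3, 5, 1, 6, 2, 4, 7], ![0, 3, 5, 1, 6, 2, 4, 7], by decide, by decide⟩,
   ⟨![1, 2, 5, 0, 6, 3, 4, 7], ![3, 0, 1, 5, 6, 2, 4, 7], by decide, by decide⟩]

/-- The six rank patterns of linear orders on three elements. -/
def six : Finset (ℕ × ℕ × ℕ) :=
  {(1, 2, 3), (1, 3, 2), (2, 1, 3), (2, 3, 1), (3, 1, 2), (3, 2, 1)}

lemma ne_of_all {a b c x : Fin 8} {i : ℕ}
    (h : witnesses.all (fun w => tripleRank w a b c x != i) = true) :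
    ∀ w ∈ witnesses, tripleRank w a b c x ≠ i := by
  simpa using h

lemma witnesses_mem : ∀ w ∈ witnesses, w ∈ D224 := by
  intro w hw
  refine ⟨?_, ?_, ?_, ?_, ?_, ?_, ?_, ?_, ?_, ?_, ?_, ?_, ?_, ?_, ?_, ?_, ?_, ?_, ?_, ?_, ?_, ?_, ?_, ?_, ?_, ?_, ?_, ?_, ?_, ?_, ?_, ?_, ?_, ?_, ?_, ?_, ?_, ?_, ?_, ?_, ?_, ?_, ?_, ?_, ?_, ?_, ?_, ?_, ?_, ?_, ?_, ?_, ?_, ?_, ?_, ?_⟩ <;>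
    exact ne_of_all (by decide +kernel) w hw

lemma ranks_mem_six (a b c : Fin 8) (hab : a < b) (hbc : b < c) (w : Equiv.Perm (Fin 8)) :
    ranks a b c w ∈ six := by
  have h1 : w.symm a ≠ w.symm b := fun h => hab.ne (w.symm.injective h)
  have h2 : w.symm b ≠ w.symm c := fun h => hbc.ne (w.symm.injective h)
  have h3 : w.symm a ≠ w.symm c := fun h => (hab.trans hbc).ne (w.symm.injective h)
  have key : ∀ x, tripleRank w a b c x = (if w.symm a ≤ w.symm x then 1 else 0) +
      ((if w.symm b ≤ w.symm x then 1 else 0) + (if w.symm c ≤ w.symm x then 1 else 0)) := by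
    intro x
    unfold tripleRank
    rw [Finset.card_filter, Finset.sum_insert, Finset.sum_insert, Finset.sum_singleton]
    · simpa using hbc.ne
    · simpa using ⟨hab.ne, (hab.trans hbc).ne⟩
  unfold ranks
  rw [key, key, key]
  generalize w.symm a = x at *
  generalize w.symm b = y at *
  generalize w.symm c = z at *
  clear key
  revert x y z
  decide +kernel

lemma ncard_aux (a b c : Fin 8) (hab : a < b) (hbc : b < c) (N : ℕ × ℕ × ℕ → Prop)
    [DecidablePred N] (hN : ∀ w ∈ D224, N (ranks a b c w))
    (h : six.filter N ⊆ (witnesses.map (ranks a b c)).toFinset ∧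
      (witnesses.map (ranks a b c)).toFinset.card = 4) :
    (ranks a b c '' D224).ncard = 4 := by
  have e : ranks a b c '' D224 = ((witnesses.map (ranks a b c)).toFinset : Set (ℕ × ℕ × ℕ)) := by
    ext p
    constructor
    · rintro ⟨w, hw, rfl⟩
      exact h.1 (Finset.mem_filter.2 ⟨ranks_mem_six a b c hab hbc w, hN w hw⟩)
    · intro hp
      simp only [Finset.mem_coe, List.mem_toFinset, List.mem_map] at hp
      obtain ⟨w, hw, rfl⟩ := hp
      exact ⟨w, witnesses_mem w hw, rfl⟩
  rw [e, Set.ncard_coe_finset, h.2]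

set_option maxHeartbeats 4000000 in
/-- `D224` is copious: for every triple `a < b < c`, the restrictions of the orders of
`D224` to `{a, b, c}` (each restriction being determined by the triple of ranks of
`a`, `b`, `c` within `{a, b, c}`) form exactly 4 distinct linear orders on `{a, b, c}`. -/
theorem stmt6 (a b c : Fin 8) (hab : a < b) (hbc : b < c) :
    ((fun w => (tripleRank w a b c a, tripleRank w a b c b, tripleRank w a b c c)) ''
      D224).ncard = 4 := by 
  change (ranks a b c '' D224).ncard = 4
  fin_cases a <;> fin_cases b <;> first
    | exact absurd hab (by decide)
    | (fin_cases c <;> first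
        | exact absurd hbc (by decide)
        | exact ncard_aux _ _ _ hab hbc (fun p => p.1 ≠ 3)
            (by rintro w ⟨h0, h1, h2, h3, h4, h5, h6, h7, h8, h9, h10, h11, h12, h13, h14, h15, h16, h17, h18, h19, h20, h21, h22, h23, h24, h25, h26, h27, h28, h29, h30, h31, h32, h33, h34, h35, h36, h37, h38, h39, h40, h41, h42, h43, h44, h45, h46, h47, h48, h49, h50, h51, h52, h53, h54, h55⟩; assumption) (by decide +kernel)
        | exact ncard_aux _ _ _ hab hbc (fun p => p.2.2 ≠ 1)
            (by rintro w ⟨h0, h1, h2, h3, h4, h5, h6, h7, h8, h9, h10, h11, h12, h13, h14, h15, h16, h17, h18, h19, h20, h21, h22, h23, h24, h25, h26, h27, h28, h29, h30, h31, h32, h33, h34, h35, h36, h37, h38, h39, h40, h41, h42, h43, h44, h45, h46, h47, h48, h49, h50, h51, h52, h53, h54, h55⟩; assumption) (by decide +kernel)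
        | exact ncard_aux _ _ _ hab hbc (fun p => p.2.1 ≠ 3)
            (by rintro w ⟨h0, h1, h2, h3, h4, h5, h6, h7, h8, h9, h10, h11, h12, h13, h14, h15, h16, h17, h18, h19, h20, h21, h22, h23, h24, h25, h26, h27, h28, h29, h30, h31, h32, h33, h34, h35, h36, h37, h38, h39, h40, h41, h42, h43, h44, h45, h46, h47, h48, h49, h50, h51, h52, h53, h54, h55⟩; assumption) (by decide +kernel)
        | exact ncard_aux _ _ _ hab hbc (fun p => p.2.1 ≠ 1)
            (by rintro w ⟨h0, h1, h2, h3, h4, h5, h6, h7, h8, h9, h10, h11, h12, h13, h14, h15, h16, h17, h18, h19, h20, h21, h22, h23, h24, h25, h26, h27, h28, h29, h30, h31, h32, h33, h34, h35, h36, h37, h38, h39, h40, h41, h42, h43, h44, h45, h46, h47, h48, h49, h50, h51, h52, h53, h54, h55⟩; assumption) (by decide +kernel))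
end

section
/- The core of D224, i.e. the set of permutations g of {1,...,8} such that g (viewed as the linear order listing g(1), g(2), ..., g(8) from top to bottom) belongs to D224 and the image of D224 under relabeling by g equals D224, is exactly the four permutations corresponding to the sequences 12345678, 12346587, 21435678 and 21436587. -/
/-- The image of a set of linear orders under relabelling of the alternatives by the
permutation `g`: each element `a` is replaced by `g a` in every order. -/
def relabel {n : ℕ} (g : Equiv.Perm (Fin n)) (D : Set (Equiv.Perm (Fin n))) :
    Set (Equiv.Perm (Fin n)) :=
  (fun w => g * w) '' D

/-- A law `(b, x, y, z)`: `x` is never first (`b = true`) or never last (`b = false`)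
in the triple `x, y, z`, in terms of the position function `p`. -/
def sat (p : Fin 8 → Fin 8) (b : Bool) (x y z : Fin 8) : Bool :=
  match b with
  | true => Nat.blt (p y).val (p x).val || Nat.blt (p z).val (p x).val
  | false => Nat.blt (p x).val (p y).val || Nat.blt (p x).val (p z).val

def laws : List (Bool × Fin 8 × Fin 8 × Fin 8) :=
  [(false, 1, 0, 2), (false, 0, 1, 3), (true, 4, 0, 1), (true, 5, 0, 1),
   (true, 6, 0, 1), (true, 7, 0, 1), (false, 0, 2, 3), (true, 4, 0, 2),
   (true, 5, 0, 2), (true, 6, 0, 2), (true, 7, 0, 2), (false, 0, 3, 4),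
   (false, 0, 3, 5), (false, 0, 3, 6), (false, 0, 3, 7), (false, 0, 4, 5),
   (false, 0, 4, 6), (true, 7, 0, 4), (true, 6, 0, 5), (false, 0, 5, 7),
   (false, 0, 6, 7), (false, 1, 2, 3), (false, 1, 2, 4), (false, 1, 2, 5),
   (false, 1, 2, 6), (false, 1, 2, 7), (true, 4, 1, 3), (true, 5, 1, 3),
   (true, 6, 1, 3), (true, 7, 1, 3), (false, 1, 4, 5), (false, 1, 4, 6),
   (true, 7, 1, 4), (true, 6, 1, 5), (false, 1, 5, 7), (false, 1, 6, 7),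
   (true, 4, 2, 3), (true, 5, 2, 3), (true, 6, 2, 3), (true, 7, 2, 3),
   (false, 2, 4, 5), (false, 2, 4, 6), (true, 7, 2, 4), (true, 6, 2, 5),
   (false, 2, 5, 7), (false, 2, 6, 7), (false, 3, 4, 5), (false, 3, 4, 6),
   (true, 7, 3, 4), (true, 6, 3, 5), (false, 3, 5, 7), (false, 3, 6, 7),
   (true, 6, 4, 5), (true, 7, 4, 5), (true, 7, 4, 6), (true, 6, 5, 7)]

/-- The laws of `laws`, closed under exchanging the two last elements. -/
def tt (b : Bool) (x y z : Fin 8) : Bool :=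
  Nat.testBit (bif b then
      3286524073518107707146277506475573990116165747742511795298038353048143929019947081997906209315144722446002224977751000738400479320526454362187369545728
    else
      43677455880950478517313684738980875993274296793996333923139118376248385472512) (64 * x.val + 8 * y.val + z.val)

theorem tt_laws : ∀ b x y z, tt b x y z = true → (b, x, y, z) ∈ laws ∨ (b, x, z, y) ∈ laws := by
  decide +kernel

theorem rank3a (w : Equiv.Perm (Fin 8)) (a b c : Fin 8) (h1 : a ≠ b) (h2 : a ≠ c) (h3 : b ≠ c) :
    tripleRank w a b c a ≠ 3 ↔ sat w.symm false a b c := by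
  have e1 : w.symm a ≠ w.symm b := fun h => h1 (w.symm.injective h)
  have e2 : w.symm a ≠ w.symm c := fun h => h2 (w.symm.injective h)
  rw [Ne, Fin.ext_iff] at e1 e2
  unfold tripleRank sat
  simp only [Finset.filter_insert, Finset.filter_singleton, Bool.or_eq_true, Nat.blt_eq]
  split_ifs <;> simp [*] <;> omega

theorem rank1a (w : Equiv.Perm (Fin 8)) (a b c : Fin 8) (h1 : a ≠ b) (h2 : a ≠ c) (h3 : b ≠ c) :
    tripleRank w a b c a ≠ 1 ↔ sat w.symm true a b c := by
  have e1 : w.symm a ≠ w.symm b := fun h => h1 (w.symm.injective h)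
  have e2 : w.symm a ≠ w.symm c := fun h => h2 (w.symm.injective h)
  rw [Ne, Fin.ext_iff] at e1 e2
  unfold tripleRank sat
  simp only [Finset.filter_insert, Finset.filter_singleton, Bool.or_eq_true, Nat.blt_eq]
  split_ifs <;> simp [*] <;> omega

theorem rank_swap (w : Equiv.Perm (Fin 8)) (a b c x : Fin 8) :
    tripleRank w a b c x = tripleRank w b a c x := by
  unfold tripleRank
  rw [Finset.insert_comm]

theorem rank_rot (w : Equiv.Perm (Fin 8)) (a b c x : Fin 8) :
    tripleRank w a b c x = tripleRank w c a b x := by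
  unfold tripleRank
  congr 2
  ext t
  simp only [Finset.mem_insert, Finset.mem_singleton]
  tauto

theorem rank3b (w : Equiv.Perm (Fin 8)) (a b c : Fin 8) (h1 : a ≠ b) (h2 : a ≠ c) (h3 : b ≠ c) :
    tripleRank w a b c b ≠ 3 ↔ sat w.symm false b a c := by
  rw [rank_swap]
  exact rank3a w b a c h1.symm h3 h2

theorem rank1b (w : Equiv.Perm (Fin 8)) (a b c : Fin 8) (h1 : a ≠ b) (h2 : a ≠ c) (h3 : b ≠ c) :
    tripleRank w a b c b ≠ 1 ↔ sat w.symm true b a c := by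
  rw [rank_swap]
  exact rank1a w b a c h1.symm h3 h2

theorem rank1c (w : Equiv.Perm (Fin 8)) (a b c : Fin 8) (h1 : a ≠ b) (h2 : a ≠ c) (h3 : b ≠ c) :
    tripleRank w a b c c ≠ 1 ↔ sat w.symm true c a b := by
  rw [rank_rot]
  exact rank1a w c a b h2.symm h3.symm h1

def satAll (p : Fin 8 → Fin 8) : Prop := ∀ t ∈ laws, sat p t.1 t.2.1 t.2.2.1 t.2.2.2

theorem satAll_of (p : Fin 8 → Fin 8)
    (h : (laws.all fun t => sat p t.1 t.2.1 t.2.2.1 t.2.2.2) = true) : satAll p :=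
  List.all_eq_true.1 h

theorem mem_iff (w : Equiv.Perm (Fin 8)) : w ∈ D224 ↔ satAll w.symm := by
  unfold D224 satAll laws
  rw [Set.mem_ofPred_eq]
  simp only [List.forall_mem_cons, List.not_mem_nil, IsEmpty.forall_iff, implies_true, and_true]
  exact and_congr (rank3b w 0 1 2 (by decide) (by decide) (by decide)) <|
    and_congr (rank3a w 0 1 3 (by decide) (by decide) (by decide)) <|
    and_congr (rank1c w 0 1 4 (by decide) (by decide) (by decide)) <|
    and_congr (rank1c w 0 1 5 (by decide) (by decide) (by decide)) <|
    and_congr (rank1c w 0 1 6 (by decide) (by decide) (by decide)) <|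
    and_congr (rank1c w 0 1 7 (by decide) (by decide) (by decide)) <|
    and_congr (rank3a w 0 2 3 (by decide) (by decide) (by decide)) <|
    and_congr (rank1c w 0 2 4 (by decide) (by decide) (by decide)) <|
    and_congr (rank1c w 0 2 5 (by decide) (by decide) (by decide)) <|
    and_congr (rank1c w 0 2 6 (by decide) (by decide) (by decide)) <|
    and_congr (rank1c w 0 2 7 (by decide) (by decide) (by decide)) <|
    and_congr (rank3a w 0 3 4 (by decide) (by decide) (by decide)) <|
    and_congr (rank3a w 0 3 5 (by decide) (by decide) (by decide)) <|
    and_congr (rank3a w 0 3 6 (by decide) (by decide) (by decide)) <|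
    and_congr (rank3a w 0 3 7 (by decide) (by decide) (by decide)) <|
    and_congr (rank3a w 0 4 5 (by decide) (by decide) (by decide)) <|
    and_congr (rank3a w 0 4 6 (by decide) (by decide) (by decide)) <|
    and_congr (rank1c w 0 4 7 (by decide) (by decide) (by decide)) <|
    and_congr (rank1c w 0 5 6 (by decide) (by decide) (by decide)) <|
    and_congr (rank3a w 0 5 7 (by decide) (by decide) (by decide)) <|
    and_congr (rank3a w 0 6 7 (by decide) (by decide) (by decide)) <|
    and_congr (rank3a w 1 2 3 (by decide) (by decide) (by decide)) <|
    and_congr (rank3a w 1 2 4 (by decide) (by decide) (by decide)) <|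
    and_congr (rank3a w 1 2 5 (by decide) (by decide) (by decide)) <|
    and_congr (rank3a w 1 2 6 (by decide) (by decide) (by decide)) <|
    and_congr (rank3a w 1 2 7 (by decide) (by decide) (by decide)) <|
    and_congr (rank1c w 1 3 4 (by decide) (by decide) (by decide)) <|
    and_congr (rank1c w 1 3 5 (by decide) (by decide) (by decide)) <|
    and_congr (rank1c w 1 3 6 (by decide) (by decide) (by decide)) <|
    and_congr (rank1c w 1 3 7 (by decide) (by decide) (by decide)) <|
    and_congr (rank3a w 1 4 5 (by decide) (by decide) (by decide)) <|
    and_congr (rank3a w 1 4 6 (by decide) (by decide) (by decide)) <|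
    and_congr (rank1c w 1 4 7 (by decide) (by decide) (by decide)) <|
    and_congr (rank1c w 1 5 6 (by decide) (by decide) (by decide)) <|
    and_congr (rank3a w 1 5 7 (by decide) (by decide) (by decide)) <|
    and_congr (rank3a w 1 6 7 (by decide) (by decide) (by decide)) <|
    and_congr (rank1c w 2 3 4 (by decide) (by decide) (by decide)) <|
    and_congr (rank1c w 2 3 5 (by decide) (by decide) (by decide)) <|
    and_congr (rank1c w 2 3 6 (by decide) (by decide) (by decide)) <|
    and_congr (rank1c w 2 3 7 (by decide) (by decide) (by decide)) <|
    and_congr (rank3a w 2 4 5 (by decide) (by decide) (by decide)) <|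
    and_congr (rank3a w 2 4 6 (by decide) (by decide) (by decide)) <|
    and_congr (rank1c w 2 4 7 (by decide) (by decide) (by decide)) <|
    and_congr (rank1c w 2 5 6 (by decide) (by decide) (by decide)) <|
    and_congr (rank3a w 2 5 7 (by decide) (by decide) (by decide)) <|
    and_congr (rank3a w 2 6 7 (by decide) (by decide) (by decide)) <|
    and_congr (rank3a w 3 4 5 (by decide) (by decide) (by decide)) <|
    and_congr (rank3a w 3 4 6 (by decide) (by decide) (by decide)) <|
    and_congr (rank1c w 3 4 7 (by decide) (by decide) (by decide)) <|
    and_congr (rank1c w 3 5 6 (by decide) (by decide) (by decide)) <|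
    and_congr (rank3a w 3 5 7 (by decide) (by decide) (by decide)) <|
    and_congr (rank3a w 3 6 7 (by decide) (by decide) (by decide)) <|
    and_congr (rank1c w 4 5 6 (by decide) (by decide) (by decide)) <|
    and_congr (rank1c w 4 5 7 (by decide) (by decide) (by decide)) <|
    and_congr (rank1c w 4 6 7 (by decide) (by decide) (by decide)) <|
    (rank1b w 5 6 7 (by decide) (by decide) (by decide))

theorem sat_tt (p : Fin 8 → Fin 8) (hp : satAll p) (b : Bool) (x y z : Fin 8)
    (h : tt b x y z = true) : sat p b x y z := by
  rcases tt_laws b x y z h with h | h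
  · exact hp _ h
  · have := hp _ h
    cases b <;> exact (Bool.or_comm _ _).trans this

theorem preserve (g : Equiv.Perm (Fin 8))
    (hg : ∀ t ∈ laws, tt t.1 (g.symm t.2.1) (g.symm t.2.2.1) (g.symm t.2.2.2) = true)
    (w : Equiv.Perm (Fin 8)) (hw : w ∈ D224) : g * w ∈ D224 := by
  rw [mem_iff] at hw ⊢
  intro t ht
  have := sat_tt _ hw _ _ _ _ (hg t ht)
  revert this
  cases t.1 <;> exact id

theorem core_of (g : Equiv.Perm (Fin 8)) (hgg : g * g = 1)
    (hg : ∀ t ∈ laws, tt t.1 (g.symm t.2.1) (g.symm t.2.2.1) (g.symm t.2.2.2) = true) :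
    g ∈ D224 ∧ relabel g D224 = D224 := by
  constructor
  · have h1 : (1 : Equiv.Perm (Fin 8)) ∈ D224 := by
      rw [mem_iff]
      exact satAll_of _ (by decide +kernel)
    simpa using preserve g hg 1 h1
  · ext w
    constructor
    · rintro ⟨v, hv, rfl⟩
      exact preserve g hg v hv
    · intro hw
      exact ⟨g * w, preserve g hg w hw, by simp [← mul_assoc, hgg]⟩

/- Five orders of the domain which together realise everything the laws permit. -/
def wit0 : Equiv.Perm (Fin 8) where
  toFun i := Fin.ofNat 8 (1985229328 / 16 ^ i.val)
  invFun i := Fin.ofNat 8 (1985229328 / 16 ^ i.val)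
  left_inv := by decide
  right_inv := by decide

def wit1 : Equiv.Perm (Fin 8) where
  toFun i := Fin.ofNat 8 (1193370883 / 16 ^ i.val)
  invFun i := Fin.ofNat 8 (1663501633 / 16 ^ i.val)
  left_inv := by decide
  right_inv := by decide

def wit2 : Equiv.Perm (Fin 8) where
  toFun i := Fin.ofNat 8 (1446016018 / 16 ^ i.val)
  invFun i := Fin.ofNat 8 (913461268 / 16 ^ i.val)
  left_inv := by decide
  right_inv := by decide

def wit3 : Equiv.Perm (Fin 8) where
  toFun i := Fin.ofNat 8 (1696691248 / 16 ^ i.val)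
  invFun i := Fin.ofNat 8 (929174848 / 16 ^ i.val)
  left_inv := by decide
  right_inv := by decide

def wit4 : Equiv.Perm (Fin 8) where
  toFun i := Fin.ofNat 8 (1949328673 / 16 ^ i.val)
  invFun i := Fin.ofNat 8 (1931890948 / 16 ^ i.val)
  left_inv := by decide
  right_inv := by decide

theorem wit_all : ∀ b : Bool, ∀ x y z : Fin 8,
    sat wit0.symm b x y z → sat wit1.symm b x y z → sat wit2.symm b x y z →
    sat wit3.symm b x y z → sat wit4.symm b x y z → tt b x y z = true := by
  decide +kernel

set_option synthInstance.maxHeartbeats 400000 in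
set_option synthInstance.maxSize 10000 in
theorem search :
    ∀ h0 : Fin 8, 
    ∀ h1 : Fin 8, 
    ∀ h2 : Fin 8, 
      (tt false h1 h0 h2 = true) →
    ∀ h3 : Fin 8, 
      (tt false h0 h1 h3 = true ∧ tt false h0 h2 h3 = true ∧ tt false h1 h2 h3 = true) →
    ∀ h4 : Fin 8, 
      (tt true h4 h0 h1 = true ∧ tt true h4 h0 h2 = true ∧ tt false h0 h3 h4 = true ∧
        tt false h1 h2 h4 = true ∧ tt true h4 h1 h3 = true ∧ tt true h4 h2 h3 = true) →
    ∀ h5 : Fin 8, 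
      (tt true h5 h0 h1 = true ∧ tt true h5 h0 h2 = true ∧ tt false h0 h3 h5 = true ∧
        tt false h0 h4 h5 = true ∧ tt false h1 h2 h5 = true ∧ tt true h5 h1 h3 = true ∧
        tt false h1 h4 h5 = true ∧ tt true h5 h2 h3 = true ∧ tt false h2 h4 h5 = true ∧
        tt false h3 h4 h5 = true) →
    ∀ h6 : Fin 8, 
      (tt true h6 h0 h1 = true ∧ tt true h6 h0 h2 = true ∧ tt false h0 h3 h6 = true ∧
        tt false h0 h4 h6 = true ∧ tt true h6 h0 h5 = true ∧ tt false h1 h2 h6 = true ∧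
        tt true h6 h1 h3 = true ∧ tt false h1 h4 h6 = true ∧ tt true h6 h1 h5 = true ∧
        tt true h6 h2 h3 = true ∧ tt false h2 h4 h6 = true ∧ tt true h6 h2 h5 = true ∧
        tt false h3 h4 h6 = true ∧ tt true h6 h3 h5 = true ∧ tt true h6 h4 h5 = true) →
    ∀ h7 : Fin 8, 
      (tt true h7 h0 h1 = true ∧ tt true h7 h0 h2 = true ∧ tt false h0 h3 h7 = true ∧
        tt true h7 h0 h4 = true ∧ tt false h0 h5 h7 = true ∧ tt false h0 h6 h7 = true ∧
        tt false h1 h2 h7 = true ∧ tt true h7 h1 h3 = true ∧ tt true h7 h1 h4 = true ∧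
        tt false h1 h5 h7 = true ∧ tt false h1 h6 h7 = true ∧ tt true h7 h2 h3 = true ∧
        tt true h7 h2 h4 = true ∧ tt false h2 h5 h7 = true ∧ tt false h2 h6 h7 = true ∧
        tt true h7 h3 h4 = true ∧ tt false h3 h5 h7 = true ∧ tt false h3 h6 h7 = true ∧
        tt true h7 h4 h5 = true ∧ tt true h7 h4 h6 = true ∧ tt true h6 h5 h7 = true) →
    [h0, h1, h2, h3, h4, h5, h6, h7] ∈
      ([[0, 1, 2, 3, 4, 5, 6, 7], [0, 1, 2, 3, 5, 4, 7, 6],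
        [1, 0, 3, 2, 4, 5, 6, 7], [1, 0, 3, 2, 5, 4, 7, 6]] : List (List (Fin 8))) := by
  decide +kernel

theorem of_core (g : Equiv.Perm (Fin 8)) (hg : ∀ w ∈ D224, g * w ∈ D224)
    (t : Bool × Fin 8 × Fin 8 × Fin 8) (ht : t ∈ laws) :
    tt t.1 (g.symm t.2.1) (g.symm t.2.2.1) (g.symm t.2.2.2) = true := by
  have key : ∀ w : Equiv.Perm (Fin 8), satAll w.symm →
      sat w.symm t.1 (g.symm t.2.1) (g.symm t.2.2.1) (g.symm t.2.2.2) := by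
    intro w hw
    have := (mem_iff _).1 (hg w ((mem_iff w).2 hw)) t ht
    revert this
    cases t.1 <;> exact id
  exact wit_all _ _ _ _ (key wit0 (satAll_of _ (by decide +kernel))) (key wit1 (satAll_of _ (by decide +kernel)))
    (key wit2 (satAll_of _ (by decide +kernel))) (key wit3 (satAll_of _ (by decide +kernel))) (key wit4 (satAll_of _ (by decide +kernel)))

theorem eq_of_values (g k : Equiv.Perm (Fin 8)) (h : ∀ i, g.symm i = k.symm i) : g = k := by
  have : g.symm = k.symm := Equiv.ext h
  simpa using congrArg Equiv.symm this

/-- The core of `D224` consists exactly of the four permutations corresponding to the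
sequences `12345678`, `12346587`, `21435678` and `21436587` (with alternative `k`
modelled as `k - 1 : Fin 8`). -/
theorem stmt10 :
    {g : Equiv.Perm (Fin 8) | g ∈ D224 ∧ relabel g D224 = D224} =
      ({1, Equiv.swap 4 5 * Equiv.swap 6 7, Equiv.swap 0 1 * Equiv.swap 2 3,
        Equiv.swap 0 1 * Equiv.swap 2 3 * (Equiv.swap 4 5 * Equiv.swap 6 7)} :
        Set (Equiv.Perm (Fin 8))) := by 
  ext g
  simp only [Set.mem_ofPred_eq, Set.mem_insert_iff, Set.mem_singleton_iff]
  constructor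
  · rintro ⟨-, hg⟩
    have hg' : ∀ w ∈ D224, g * w ∈ D224 := by
      intro w hw
      rw [← hg]
      exact ⟨w, hw, rfl⟩
    have H : ∀ b x y z, (b, x, y, z) ∈ laws →
        tt b (g.symm x) (g.symm y) (g.symm z) = true := fun b x y z h => of_core g hg' _ h
    have S := search
      (g.symm 0)
      (g.symm 1)
      (g.symm 2)
      (H _ _ _ _ (by decide))
      (g.symm 3)
      ⟨H _ _ _ _ (by decide), H _ _ _ _ (by decide), H _ _ _ _ (by decide)⟩
      (g.symm 4)
      ⟨H _ _ _ _ (by decide), H _ _ _ _ (by decide), H _ _ _ _ (by decide),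
        H _ _ _ _ (by decide), H _ _ _ _ (by decide), H _ _ _ _ (by decide)⟩
      (g.symm 5)
      ⟨H _ _ _ _ (by decide), H _ _ _ _ (by decide), H _ _ _ _ (by decide),
        H _ _ _ _ (by decide), H _ _ _ _ (by decide), H _ _ _ _ (by decide),
        H _ _ _ _ (by decide), H _ _ _ _ (by decide), H _ _ _ _ (by decide),
        H _ _ _ _ (by decide)⟩
      (g.symm 6)
      ⟨H _ _ _ _ (by decide), H _ _ _ _ (by decide), H _ _ _ _ (by decide),
        H _ _ _ _ (by decide), H _ _ _ _ (by decide), H _ _ _ _ (by decide),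
        H _ _ _ _ (by decide), H _ _ _ _ (by decide), H _ _ _ _ (by decide),
        H _ _ _ _ (by decide), H _ _ _ _ (by decide), H _ _ _ _ (by decide),
        H _ _ _ _ (by decide), H _ _ _ _ (by decide), H _ _ _ _ (by decide)⟩
      (g.symm 7)
      ⟨H _ _ _ _ (by decide), H _ _ _ _ (by decide), H _ _ _ _ (by decide),
        H _ _ _ _ (by decide), H _ _ _ _ (by decide), H _ _ _ _ (by decide),
        H _ _ _ _ (by decide), H _ _ _ _ (by decide), H _ _ _ _ (by decide),
        H _ _ _ _ (by decide), H _ _ _ _ (by decide), H _ _ _ _ (by decide),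
        H _ _ _ _ (by decide), H _ _ _ _ (by decide), H _ _ _ _ (by decide),
        H _ _ _ _ (by decide), H _ _ _ _ (by decide), H _ _ _ _ (by decide),
        H _ _ _ _ (by decide), H _ _ _ _ (by decide), H _ _ _ _ (by decide)⟩
    simp only [List.mem_cons, List.cons.injEq, List.not_mem_nil, or_false, and_true] at S
    rcases S with S | S | S | S
    · left
      apply eq_of_values
      obtain ⟨h0, h1, h2, h3, h4, h5, h6, h7⟩ := S
      intro i
      fin_cases i
      exacts [h0, h1, h2, h3, h4, h5, h6, h7]
    · right; left
      apply eq_of_values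
      obtain ⟨h0, h1, h2, h3, h4, h5, h6, h7⟩ := S
      intro i
      fin_cases i
      exacts [h0, h1, h2, h3, h4, h5, h6, h7]
    · right; right; left
      apply eq_of_values
      obtain ⟨h0, h1, h2, h3, h4, h5, h6, h7⟩ := S
      intro i
      fin_cases i
      exacts [h0, h1, h2, h3, h4, h5, h6, h7]
    · right; right; right
      apply eq_of_values
      obtain ⟨h0, h1, h2, h3, h4, h5, h6, h7⟩ := S
      intro i
      fin_cases i
      exacts [h0, h1, h2, h3, h4, h5, h6, h7]
  · rintro (rfl | rfl | rfl | rfl)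
    · exact core_of _ (Equiv.ext (by decide +kernel)) (List.all_eq_true.1 (by decide +kernel))
    · exact core_of _ (Equiv.ext (by decide +kernel)) (List.all_eq_true.1 (by decide +kernel))
    · exact core_of _ (Equiv.ext (by decide +kernel)) (List.all_eq_true.1 (by decide +kernel))
    · exact core_of _ (Equiv.ext (by decide +kernel)) (List.all_eq_true.1 (by decide +kernel))
end
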